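/- Let a normal-form feasible schedule of the constructed instance with makespan W be given in which the job processed on machine 2 with start time 0 belongs to B. Then machine 4 processes its jobs in the order B_0, β^{(1)}, b^{(1)}, B_1, β^{(2)}, b^{(2)}, B_2, …, β^{(z)}, b^{(z)}, B_z, λ_2, where between consecutive B-jobs exactly one job of β is followed by exactly one job of b; consequently σ(B_i) = i(D²+D³+D⁴+D⁵+D⁶) + i(7z−1)D⁷ + iD⁸ for all i ∈ {0,…,z}. -/

import Mathlib

/-- Jobs of the instance constructed from a 3-Partition instance with parameter `z`. -/
inductive Job (z : ℕ) : Type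
  | JA (i : Fin (z+1))
  | JB (i : Fin (z+1))
  | Ja (i : Fin z)
  | Jb (i : Fin z)
  | Jc (j : Fin (z+1))
  | Jα (i : Fin z)
  | Jβ (i : Fin z)
  | Jγ (j : Fin z)
  | Jδ (j : Fin z)
  | Jl1
  | Jl2
  | Jpart (i : Fin (3*z))
  deriving DecidableEq, Fintype

/-- Processing times of the constructed jobs (`γ_j`, `δ_j` use index `j ∈ {1,…,z}`,
represented by `j.val + 1` for `j : Fin z`). -/
def pJob (z D : ℕ) (ι : Fin (3*z) → ℕ) : Job z → ℕ
  | .JA _ => D^2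
  | .JB _ => D^3
  | .Ja _ => D^4 + D^6 + 3*z*D^7
  | .Jb _ => D^5 + D^6 + 3*z*D^7
  | .Jc j => (z + j.val)*D^7 + D^8
  | .Jα _ => D^3 + D^5 + 4*z*D^7 + D^8
  | .Jβ _ => D^2 + D^4 + (4*z-1)*D^7 + D^8
  | .Jγ j => D^5 + (3*z - (j.val+1))*D^7 - D
  | .Jδ j => D^4 + (3*z - (j.val+1))*D^7
  | .Jl1 => D^3 + z*D^7 + D^8
  | .Jl2 => D^2 + 2*z*D^7 + D^8
  | .Jpart i => ι i

/-- Machine requirements of the constructed jobs. -/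
def qJob (z : ℕ) : Job z → ℕ
  | .JA _ => 3
  | .JB _ => 3
  | .Ja _ => 2
  | .Jb _ => 2
  | .Jc _ => 2
  | _ => 1

/-- Feasibility of a schedule `(σ, ρ)` on machines `{1,…,m}`: every job gets `q j`
machines among `{1,…,m}`, and jobs sharing a machine have disjoint half-open intervals. -/
def Feasible {J : Type} (m : ℕ) (p q : J → ℕ) (σ : J → ℕ) (ρ : J → Finset ℕ) : Prop :=
  (∀ j, ρ j ⊆ Finset.Icc 1 m) ∧ (∀ j, (ρ j).card = q j) ∧
  (∀ j j', j ≠ j' → (ρ j ∩ ρ j').Nonempty →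
    σ j + p j ≤ σ j' ∨ σ j' + p j' ≤ σ j)

/-- Makespan of a schedule. -/
def makespan {J : Type} [Fintype J] (p σ : J → ℕ) : ℕ :=
  Finset.univ.sup fun j => σ j + p j

/-- The target makespan `W`. -/
def Wval (z D : ℕ) : ℕ :=
  (z+1)*(D^2 + D^3 + D^8) + z*(D^4 + D^5 + D^6) + z*(7*z+1)*D^7

/-- The 3-Partition instance `ι` is a Yes-instance. -/
def IsYes (z D : ℕ) (ι : Fin (3*z) → ℕ) : Prop :=
  ∃ f : Fin (3*z) → Fin z,
    ∀ k : Fin z, ∑ i ∈ Finset.univ.filter (fun i => f i = k), ι i = D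

/-- Jobs processed on machine 1 in a normal-form schedule: `A ∪ a ∪ α ∪ {λ₁}`. -/
def M1Jobs {z : ℕ} : Job z → Prop
  | .JA _ => True
  | .Ja _ => True
  | .Jα _ => True
  | .Jl1 => True
  | _ => False

/-- Jobs processed on machine 4 in a normal-form schedule: `B ∪ b ∪ β ∪ {λ₂}`. -/
def M4Jobs {z : ℕ} : Job z → Prop
  | .JB _ => True
  | .Jb _ => True
  | .Jβ _ => True
  | .Jl2 => True
  | _ => False

/-- Jobs processed on both machines 2 and 3: `A ∪ B ∪ c`. -/
def BothM23 {z : ℕ} : Job z → Prop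
  | .JA _ => True
  | .JB _ => True
  | .Jc _ => True
  | _ => False

/-- Jobs processed on exactly one of machines 2 and 3: `a ∪ b ∪ γ ∪ δ ∪ P`. -/
def OneM23 {z : ℕ} : Job z → Prop
  | .Ja _ => True
  | .Jb _ => True
  | .Jγ _ => True
  | .Jδ _ => True
  | .Jpart _ => True
  | _ => False

/-- Normal form of a schedule of the constructed instance. -/
def NormalForm {z : ℕ} (ρ : Job z → Finset ℕ) : Prop :=
  (∀ j, 1 ∈ ρ j ↔ M1Jobs j) ∧
  (∀ j, 4 ∈ ρ j ↔ M4Jobs j) ∧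
  (∀ j, BothM23 j → 2 ∈ ρ j ∧ 3 ∈ ρ j) ∧
  (∀ j, OneM23 j → ((2 ∈ ρ j) ↔ ¬ (3 ∈ ρ j)))

/-- `cnt p σ S i` = number of jobs of `S` finishing no later than the start of `i`
(the quantity `#ᵢ S`). -/
def cnt {z : ℕ} (p σ : Job z → ℕ) (S : Finset (Job z)) (i : Job z) : ℕ :=
  (S.filter fun j => σ j + p j ≤ σ i).card

def sA (z : ℕ) : Finset (Job z) := Finset.univ.image Job.JA
def sB (z : ℕ) : Finset (Job z) := Finset.univ.image Job.JB
def sa (z : ℕ) : Finset (Job z) := Finset.univ.image Job.Ja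
def sb (z : ℕ) : Finset (Job z) := Finset.univ.image Job.Jb
def sc (z : ℕ) : Finset (Job z) := Finset.univ.image Job.Jc
def sα (z : ℕ) : Finset (Job z) := Finset.univ.image Job.Jα
def sβ (z : ℕ) : Finset (Job z) := Finset.univ.image Job.Jβ
def sγ (z : ℕ) : Finset (Job z) := Finset.univ.image Job.Jγ
def sδ (z : ℕ) : Finset (Job z) := Finset.univ.image Job.Jδ


section helpers

open Finset

variable {z : ℕ}

def cN (p σ : Job z → ℕ) {n : ℕ} (f : Fin n → Job z) (t : ℕ) : ℕ :=
  (univ.filter fun i => σ (f i) + p (f i) ≤ t).card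

def cK (p σ : Job z → ℕ) (ρ : Job z → Finset ℕ) (k : ℕ) {n : ℕ} (f : Fin n → Job z) (t : ℕ) : ℕ :=
  (univ.filter fun i => k ∈ ρ (f i) ∧ σ (f i) + p (f i) ≤ t).card

theorem cN_mono (p σ : Job z → ℕ) {n : ℕ} (f : Fin n → Job z) {s t : ℕ} (h : s ≤ t) :
    cN p σ f s ≤ cN p σ f t := by
  apply card_le_card
  intro i
  simp only [mem_filter, mem_univ, true_and]
  omega

theorem cK_mono (p σ : Job z → ℕ) (ρ : Job z → Finset ℕ) (k : ℕ) {n : ℕ} (f : Fin n → Job z)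
    {s t : ℕ} (h : s ≤ t) : cK p σ ρ k f s ≤ cK p σ ρ k f t := by
  apply card_le_card
  intro i
  simp only [mem_filter, mem_univ, true_and]
  rintro ⟨h1, h2⟩
  exact ⟨h1, by omega⟩

theorem cN_le (p σ : Job z → ℕ) {n : ℕ} (f : Fin n → Job z) (t : ℕ) : cN p σ f t ≤ n := by
  have := card_filter_le (univ : Finset (Fin n)) (fun i => σ (f i) + p (f i) ≤ t)
  simpa [cN] using this

theorem cK_le (p σ : Job z → ℕ) (ρ : Job z → Finset ℕ) (k : ℕ) {n : ℕ} (f : Fin n → Job z)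
    (t : ℕ) : cK p σ ρ k f t ≤ n := by
  have := card_filter_le (univ : Finset (Fin n)) (fun i => k ∈ ρ (f i) ∧ σ (f i) + p (f i) ≤ t)
  simpa [cK] using this

theorem cN_lt (p σ : Job z → ℕ) {n : ℕ} (f : Fin n → Job z) (y : Fin n) {s t : ℕ}
    (hs : s < σ (f y) + p (f y)) (ht : σ (f y) + p (f y) ≤ t) :
    cN p σ f s < cN p σ f t := by
  apply card_lt_card
  rw [Finset.ssubset_iff_of_subset]
  · exact ⟨y, by simpa using ht, by simpa using hs⟩
  · intro i
    simp only [mem_filter, mem_univ, true_and]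
    omega

theorem cK_lt (p σ : Job z → ℕ) (ρ : Job z → Finset ℕ) (k : ℕ) {n : ℕ} (f : Fin n → Job z)
    (y : Fin n) (hk : k ∈ ρ (f y)) {s t : ℕ}
    (hs : s < σ (f y) + p (f y)) (ht : σ (f y) + p (f y) ≤ t) :
    cK p σ ρ k f s < cK p σ ρ k f t := by
  apply card_lt_card
  rw [Finset.ssubset_iff_of_subset]
  · exact ⟨y, by simpa using ⟨hk, ht⟩, by simpa using fun _ => hs⟩
  · intro i
    simp only [mem_filter, mem_univ, true_and]
    rintro ⟨h1, h2⟩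
    exact ⟨h1, by omega⟩

theorem cK_ex (p σ : Job z → ℕ) (ρ : Job z → Finset ℕ) (k : ℕ) {n : ℕ} (f : Fin n → Job z)
    {s t : ℕ} (h : cK p σ ρ k f s < cK p σ ρ k f t) :
    ∃ y, k ∈ ρ (f y) ∧ s < σ (f y) + p (f y) ∧ σ (f y) + p (f y) ≤ t := by
  obtain ⟨y, hy, hy'⟩ := exists_mem_notMem_of_card_lt_card h
  simp only [mem_filter, mem_univ, true_and, not_and, not_le] at hy hy'
  exact ⟨y, hy.1, hy' hy.1, hy.2⟩

/-- jobs in the class pairwise do not overlap -/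
def Chain (p σ : Job z → ℕ) {n : ℕ} (f : Fin n → Job z) : Prop :=
  ∀ i j, i ≠ j → σ (f i) + p (f i) ≤ σ (f j) ∨ σ (f j) + p (f j) ≤ σ (f i)

theorem nth_ex (p σ : Job z → ℕ) (hp : ∀ j, 0 < p j) {n : ℕ} (f : Fin n → Job z)
    (hf : Chain p σ f) (i : ℕ) (hi : i < n) : ∃ y, cN p σ f (σ (f y)) = i := by
  have hlt : ∀ y, cN p σ f (σ (f y)) < n := fun y => by
    have := cN_lt p σ f y (s := σ (f y)) (t := σ (f y) + p (f y)) (by have := hp (f y); omega) le_rfl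
    exact lt_of_lt_of_le this (cN_le _ _ _ _)
  let g : Fin n → Fin n := fun y => ⟨_, hlt y⟩
  have key : ∀ x y, σ (f x) + p (f x) ≤ σ (f y) → g x ≠ g y := fun x y h h' => by
    have := cN_lt p σ f x (s := σ (f x)) (t := σ (f y)) (by have := hp (f x); omega) h
    simp only [g, Fin.mk.injEq] at h'
    omega
  have hinj : Function.Injective g := by
    intro x y hxy
    by_contra hne
    rcases hf x y hne with h | h
    · exact key x y h hxy
    · exact key y x h hxy.symm
  obtain ⟨y, hy⟩ := (Finite.injective_iff_surjective.mp hinj) ⟨i, hi⟩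
  exact ⟨y, by simpa [g] using hy⟩

theorem nth_iff (p σ : Job z → ℕ) (hp : ∀ j, 0 < p j) {n : ℕ} (f : Fin n → Job z)
    (hf : Chain p σ f) (y : Fin n) (t : ℕ) :
    σ (f y) + p (f y) ≤ t ↔ cN p σ f (σ (f y)) < cN p σ f t := by
  constructor
  · intro h
    exact cN_lt p σ f y (by have := hp (f y); omega) h
  · intro h
    by_contra hc
    apply absurd h
    rw [not_lt]
    apply card_le_card
    intro i
    simp only [mem_filter, mem_univ, true_and]
    intro h1
    have hne : i ≠ y := by rintro rfl; omega
    have := hp (f i)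
    rcases hf i y hne with h | h <;> omega

theorem sum_le_of_disj {J : Type} [DecidableEq J] (p σ : J → ℕ) (S : Finset J) (l u : ℕ)
    (hS : ∀ i ∈ S, ∀ j ∈ S, i ≠ j → σ i + p i ≤ σ j ∨ σ j + p j ≤ σ i)
    (hl : ∀ i ∈ S, l ≤ σ i) (hu : ∀ i ∈ S, σ i + p i ≤ u) : ∑ i ∈ S, p i ≤ u - l := by
  have h1 : (S.biUnion fun i => Finset.Ico (σ i) (σ i + p i)).card = ∑ i ∈ S, p i := by
    rw [card_biUnion]
    · simp
    · intro i hi j hj hij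
      rw [Function.onFun, Finset.disjoint_left]
      intro a
      simp only [Finset.mem_Ico]
      have := hS i hi j hj hij
      omega
  rw [← h1, ← Nat.card_Ico]
  apply card_le_card
  intro a
  simp only [mem_biUnion, Finset.mem_Ico]
  rintro ⟨i, hi, h2⟩
  have := hl i hi
  have := hu i hi
  omega

theorem mach_formula {J : Type} [Fintype J] [DecidableEq J] (p σ : J → ℕ) (S : Finset J) (W : ℕ)
    (hS : ∀ i ∈ S, ∀ j ∈ S, i ≠ j → σ i + p i ≤ σ j ∨ σ j + p j ≤ σ i)
    (hu : ∀ i ∈ S, σ i + p i ≤ W) (hW : ∑ i ∈ S, p i = W) (x : J) (hx : x ∈ S) :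
    σ x = ∑ j ∈ S, if σ j + p j ≤ σ x then p j else 0 := by
  rw [← sum_filter]
  have h1 := sum_le_of_disj p σ (S.filter fun j => σ j + p j ≤ σ x) 0 (σ x)
    (fun i hi j hj => hS i (mem_of_mem_filter i hi) j (mem_of_mem_filter j hj))
    (by simp) (fun i hi => (mem_filter.mp hi).2)
  have h2 := sum_le_of_disj p σ (S.filter fun j => ¬ σ j + p j ≤ σ x) (σ x) W
    (fun i hi j hj => hS i (mem_of_mem_filter i hi) j (mem_of_mem_filter j hj))
    (fun i hi => by
      have h := mem_filter.mp hi
      by_cases hix : i = x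
      · rw [hix]
      · rcases hS i h.1 x hx hix with h' | h'
        · exact absurd h' h.2
        · omega)
    (fun i hi => hu i (mem_of_mem_filter i hi))
  have h3 := sum_filter_add_sum_filter_not S (fun j => σ j + p j ≤ σ x) p
  have h4 := hu x hx
  omega

def jobEquiv (z : ℕ) : Job z ≃ (Fin (z+1) ⊕ Fin (z+1) ⊕ Fin z ⊕ Fin z ⊕ Fin (z+1) ⊕ Fin z ⊕ Fin z ⊕
    Fin z ⊕ Fin z ⊕ Fin 1 ⊕ Fin 1 ⊕ Fin (3*z)) where
  toFun
    | .JA i => .inl i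
    | .JB i => .inr (.inl i)
    | .Ja i => .inr (.inr (.inl i))
    | .Jb i => .inr (.inr (.inr (.inl i)))
    | .Jc i => .inr (.inr (.inr (.inr (.inl i))))
    | .Jα i => .inr (.inr (.inr (.inr (.inr (.inl i)))))
    | .Jβ i => .inr (.inr (.inr (.inr (.inr (.inr (.inl i))))))
    | .Jγ i => .inr (.inr (.inr (.inr (.inr (.inr (.inr (.inl i)))))))
    | .Jδ i => .inr (.inr (.inr (.inr (.inr (.inr (.inr (.inr (.inl i))))))))
    | .Jl1 => .inr (.inr (.inr (.inr (.inr (.inr (.inr (.inr (.inr (.inl 0)))))))))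
    | .Jl2 => .inr (.inr (.inr (.inr (.inr (.inr (.inr (.inr (.inr (.inr (.inl 0))))))))))
    | .Jpart i => .inr (.inr (.inr (.inr (.inr (.inr (.inr (.inr (.inr (.inr (.inr i))))))))))
  invFun
    | .inl i => .JA i
    | .inr (.inl i) => .JB i
    | .inr (.inr (.inl i)) => .Ja i
    | .inr (.inr (.inr (.inl i))) => .Jb i
    | .inr (.inr (.inr (.inr (.inl i)))) => .Jc i
    | .inr (.inr (.inr (.inr (.inr (.inl i))))) => .Jα i
    | .inr (.inr (.inr (.inr (.inr (.inr (.inl i)))))) => .Jβ i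
    | .inr (.inr (.inr (.inr (.inr (.inr (.inr (.inl i))))))) => .Jγ i
    | .inr (.inr (.inr (.inr (.inr (.inr (.inr (.inr (.inl i)))))))) => .Jδ i
    | .inr (.inr (.inr (.inr (.inr (.inr (.inr (.inr (.inr (.inl _))))))))) => .Jl1
    | .inr (.inr (.inr (.inr (.inr (.inr (.inr (.inr (.inr (.inr (.inl _)))))))))) => .Jl2
    | .inr (.inr (.inr (.inr (.inr (.inr (.inr (.inr (.inr (.inr (.inr i)))))))))) => .Jpart i
  left_inv := by rintro (_ | _ | _ | _ | _ | _ | _ | _ | _ | _ | _ | _) <;> rfl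
  right_inv := by
    rintro (_ | _ | _ | _ | _ | _ | _ | _ | _ | i | i | _) <;>
      first | rfl | (obtain rfl := Subsingleton.elim i 0; rfl)

theorem sum_job (F : Job z → ℕ) : ∑ j, F j = ∑ i, F (.JA i) + ∑ i, F (.JB i) + ∑ i, F (.Ja i) +
    ∑ i, F (.Jb i) + ∑ i, F (.Jc i) + ∑ i, F (.Jα i) + ∑ i, F (.Jβ i) + ∑ i, F (.Jγ i) +
    ∑ i, F (.Jδ i) + ∑ _i : Fin 1, F .Jl1 + ∑ _i : Fin 1, F .Jl2 + ∑ i, F (.Jpart i) := by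
  rw [← Equiv.sum_comp (jobEquiv z).symm]
  simp only [Fintype.sum_sum_type]
  simp only [jobEquiv, Equiv.coe_fn_symm_mk]
  ring

theorem sum_ite_cN (p σ : Job z → ℕ) {n : ℕ} (f : Fin n → Job z) (t q : ℕ) :
    (∑ i, if σ (f i) + p (f i) ≤ t then q else 0) = cN p σ f t * q := by
  rw [← sum_filter, sum_const, smul_eq_mul, cN]

theorem sum_ite_cK (p σ : Job z → ℕ) (ρ : Job z → Finset ℕ) (k : ℕ) {n : ℕ} (f : Fin n → Job z)
    (t q : ℕ) :
    (∑ i, if k ∈ ρ (f i) ∧ σ (f i) + p (f i) ≤ t then q else 0) = cK p σ ρ k f t * q := by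
  rw [← sum_filter, sum_const, smul_eq_mul, cK]

theorem digit1 (D d e x y : ℕ) (hd : d < D) (he : e < D) (h : d + D * x = e + D * y) :
    d = e ∧ x = y := by
  have h1 : (d + D * x) % D = d := by rw [Nat.add_mul_mod_self_left, Nat.mod_eq_of_lt hd]
  have h2 : (e + D * y) % D = e := by rw [Nat.add_mul_mod_self_left, Nat.mod_eq_of_lt he]
  have h3 : d = e := by rw [← h1, ← h2, h]
  subst h3
  exact ⟨rfl, Nat.eq_of_mul_eq_mul_left (by omega) (by omega : D * x = D * y)⟩

theorem digits (D X Y d2 d3 d4 d5 d6 d7 d8 e2 e3 e4 e5 e6 e7 e8 : ℕ) (hX : X < D * D)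
    (hY : Y < D * D) (hd2 : d2 < D) (hd3 : d3 < D) (hd4 : d4 < D) (hd5 : d5 < D) (hd6 : d6 < D)
    (hd7 : d7 < D)
    (he2 : e2 < D) (he3 : e3 < D) (he4 : e4 < D) (he5 : e5 < D) (he6 : e6 < D) (he7 : e7 < D)
    (h : X + d2 * D^2 + d3 * D^3 + d4 * D^4 + d5 * D^5 + d6 * D^6 + d7 * D^7 + d8 * D^8 =
      Y + e2 * D^2 + e3 * D^3 + e4 * D^4 + e5 * D^5 + e6 * D^6 + e7 * D^7 + e8 * D^8) :
    X = Y ∧ d2 = e2 ∧ d3 = e3 ∧ d4 = e4 ∧ d5 = e5 ∧ d6 = e6 ∧ d7 = e7 ∧ d8 = e8 := by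
  obtain ⟨h0, h⟩ := digit1 (D * D) X Y
    (d2 + D * (d3 + D * (d4 + D * (d5 + D * (d6 + D * (d7 + D * d8))))))
    (e2 + D * (e3 + D * (e4 + D * (e5 + D * (e6 + D * (e7 + D * e8)))))) hX hY (by
      ring_nf at h ⊢; exact h)
  obtain ⟨h2, h⟩ := digit1 _ _ _ _ _ hd2 he2 h
  obtain ⟨h3, h⟩ := digit1 _ _ _ _ _ hd3 he3 h
  obtain ⟨h4, h⟩ := digit1 _ _ _ _ _ hd4 he4 h
  obtain ⟨h5, h⟩ := digit1 _ _ _ _ _ hd5 he5 h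
  obtain ⟨h6, h⟩ := digit1 _ _ _ _ _ hd6 he6 h
  obtain ⟨h7, h⟩ := digit1 _ _ _ _ _ hd7 he7 h
  exact ⟨h0, h2, h3, h4, h5, h6, h7, h⟩

structure Ctx (z D : ℕ) (ι : Fin (3*z) → ℕ) (σ : Job z → ℕ) (ρ : Job z → Finset ℕ) : Prop where
  hz : 0 < z
  hpos : ∀ i, 0 < ι i
  hsum : ∑ i, ι i = z * D
  hD : 4*z*(7*z+1) < D
  hfeas : Feasible 4 (pJob z D ι) (qJob z) σ ρ
  hmk : makespan (pJob z D ι) σ = Wval z D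
  hnf : NormalForm ρ

variable {D : ℕ} {ι : Fin (3*z) → ℕ} {σ : Job z → ℕ} {ρ : Job z → Finset ℕ}

theorem Ctx.D1 (H : Ctx z D ι σ ρ) : 4 < D := by
  have := H.hD
  have := H.hz
  nlinarith

theorem Ctx.pγ (_H : Ctx z D ι σ ρ) (j : Fin z) :
    pJob z D ι (.Jγ j) + D = D^5 + (3*z - (j.val+1))*D^7 := by
  have h : D ≤ D^5 := Nat.le_self_pow (by norm_num) D
  simp only [pJob]
  omega

theorem Ctx.ppos (H : Ctx z D ι σ ρ) (j : Job z) : 0 < pJob z D ι j := by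
  have hD := H.D1
  have hD' : 0 < D := by omega
  cases j with
  | Jpart i => exact H.hpos i
  | Jγ j =>
    have := H.pγ j
    have h2 : D < D^5 := by
      calc D = D^1 := by ring
        _ < D^5 := Nat.pow_lt_pow_right (by omega) (by norm_num)
    omega
  | _ => simp only [pJob]; positivity

theorem Ctx.disj (H : Ctx z D ι σ ρ) (k : ℕ) {x y : Job z} (hx : k ∈ ρ x) (hy : k ∈ ρ y)
    (hne : x ≠ y) :
    σ x + pJob z D ι x ≤ σ y ∨ σ y + pJob z D ι y ≤ σ x :=
  H.hfeas.2.2 x y hne ⟨k, by simp [hx, hy]⟩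

theorem Ctx.leW (H : Ctx z D ι σ ρ) (x : Job z) : σ x + pJob z D ι x ≤ Wval z D := by
  rw [← H.hmk]
  exact Finset.le_sup (f := fun j => σ j + pJob z D ι j) (Finset.mem_univ x)

theorem Ctx.nm (H : Ctx z D ι σ ρ) {x : Job z} (hq : qJob z x = 1) {k l : ℕ} (hk : k ∈ ρ x)
    (hkl : l ≠ k) : l ∉ ρ x := by
  have h := H.hfeas.2.1 x
  rw [hq, Finset.card_eq_one] at h
  obtain ⟨a, ha⟩ := h
  rw [ha] at hk ⊢
  simp only [Finset.mem_singleton] at *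
  omega

theorem Ctx.m1 (H : Ctx z D ι σ ρ) (x : Job z) : 1 ∈ ρ x ↔ M1Jobs x := H.hnf.1 x
theorem Ctx.m4 (H : Ctx z D ι σ ρ) (x : Job z) : 4 ∈ ρ x ↔ M4Jobs x := H.hnf.2.1 x

def wJ : Job z → ℕ
  | .JA _ => 2
  | .JB _ => 2
  | .Jc _ => 2
  | .Jα _ => 0
  | .Jβ _ => 0
  | .Jl1 => 0
  | .Jl2 => 0
  | _ => 1

theorem Ctx.both (H : Ctx z D ι σ ρ) (x : Job z) (h : BothM23 x) {k : ℕ} (hk : k = 2 ∨ k = 3) :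
    k ∈ ρ x := by
  have := H.hnf.2.2.1 x h
  rcases hk with rfl | rfl
  · exact this.1
  · exact this.2

theorem Ctx.none (H : Ctx z D ι σ ρ) (x : Job z) (h : wJ x = 0) {k : ℕ} (hk : k = 2 ∨ k = 3) :
    k ∉ ρ x := by
  have h1 := H.m1 x
  have h4 := H.m4 x
  cases x <;> simp only [wJ, M1Jobs, M4Jobs, iff_true, iff_false] at h h1 h4 <;>
    first
    | exact H.nm rfl h1 (by omega)
    | exact H.nm rfl h4 (by omega)
    | exact absurd h (by norm_num)

theorem Ctx.w23 (H : Ctx z D ι σ ρ) (x : Job z) (q : ℕ) :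
    (if 2 ∈ ρ x then q else 0) + (if 3 ∈ ρ x then q else 0) = wJ x * q := by
  have hb := H.hnf.2.2.1 x
  have ho := H.hnf.2.2.2 x
  have hn := fun h => H.none x h (Or.inl (rfl : 2 = 2))
  have hn' := fun h => H.none x h (Or.inr (rfl : 3 = 3))
  by_cases h2 : 2 ∈ ρ x <;> by_cases h3 : 3 ∈ ρ x <;> simp only [h2, h3] at hb ho hn hn' ⊢ <;>
    cases x <;> simp [BothM23, OneM23, wJ] at * <;> omega

theorem gauss1 (z : ℕ) : 2 * ∑ j : Fin (z+1), (j.val) = z * (z+1) := by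
  rw [Fin.sum_univ_eq_sum_range (fun i => i) (z+1)]
  have := Finset.sum_range_id_mul_two (z+1)
  simp only [Nat.add_sub_cancel] at this
  linarith

theorem gauss2 (z : ℕ) : 2 * ∑ j : Fin z, (3*z - (j.val+1)) + z * (z+1) = 6*z*z := by
  have h1 : ∑ j : Fin z, (3*z - (j.val+1)) + ∑ j : Fin z, (j.val+1) = ∑ j : Fin z, 3 * z := by
    rw [← Finset.sum_add_distrib]
    apply Finset.sum_congr rfl
    intro j _
    omega
  have h2 := gauss1 z
  rw [Fin.sum_univ_succ] at h2
  simp only [Fin.val_zero, zero_add, Fin.val_succ] at h2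
  simp only [Finset.sum_const, Finset.card_univ, Fintype.card_fin, smul_eq_mul] at h1
  nlinarith

theorem Ctx.load1 (H : Ctx z D ι σ ρ) :
    ∑ j ∈ univ.filter (fun j => 1 ∈ ρ j), pJob z D ι j = Wval z D := by
  rw [Finset.sum_filter, sum_job]
  simp only [H.m1, M1Jobs, if_true, if_false, pJob, Finset.sum_const, Finset.card_univ,
    Fintype.card_fin, smul_eq_mul, Wval]
  ring

theorem Ctx.load4 (H : Ctx z D ι σ ρ) :
    ∑ j ∈ univ.filter (fun j => 4 ∈ ρ j), pJob z D ι j = Wval z D := by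
  rw [Finset.sum_filter, sum_job]
  simp only [H.m4, M4Jobs, if_true, if_false, pJob, Finset.sum_const, Finset.card_univ,
    Fintype.card_fin, smul_eq_mul, Wval]
  obtain ⟨u, hu⟩ : ∃ u, 4 * z = u + 1 := ⟨4*z-1, by have := H.hz; omega⟩
  have hu' : 4*z - 1 = u := by omega
  rw [hu']
  zify at hu ⊢
  have : (u:ℤ) = 4*z - 1 := by omega
  rw [this]
  ring

theorem Ctx.load23 (H : Ctx z D ι σ ρ) :
    ∑ j ∈ univ.filter (fun j => 2 ∈ ρ j), pJob z D ι j +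
    ∑ j ∈ univ.filter (fun j => 3 ∈ ρ j), pJob z D ι j = 2 * Wval z D := by
  rw [Finset.sum_filter, Finset.sum_filter, ← Finset.sum_add_distrib]
  simp only [H.w23]
  have hγ : ∑ j : Fin z, pJob z D ι (.Jγ j) + z * D =
      z * D^5 + (∑ j : Fin z, (3*z - (j.val+1))) * D^7 := by
    have : ∑ j : Fin z, (pJob z D ι (.Jγ j) + D) =
      ∑ j : Fin z, (D^5 + (3*z - (j.val+1))*D^7) := Finset.sum_congr rfl fun j _ => H.pγ j
    simpa [Finset.sum_add_distrib, Finset.sum_mul] using this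
  rw [sum_job]
  simp only [wJ, one_mul, zero_mul, Finset.sum_const_zero]
  generalize hg : ∑ j : Fin z, pJob z D ι (.Jγ j) = g at *
  simp only [pJob, H.hsum, Finset.sum_add_distrib, ← Finset.mul_sum, ← Finset.sum_mul,
    Finset.sum_const, Finset.card_univ, Fintype.card_fin, smul_eq_mul, Wval]
  have g1 := gauss1 z
  have g2 := gauss2 z
  generalize ∑ j : Fin (z+1), (j.val) = u at *
  generalize ∑ j : Fin z, (3*z - (j.val+1)) = v at *
  zify at *
  linear_combination hγ + (D:ℤ)^7 * (g1 + g2)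

theorem Ctx.loadle (H : Ctx z D ι σ ρ) (k : ℕ) :
    ∑ j ∈ univ.filter (fun j => k ∈ ρ j), pJob z D ι j ≤ Wval z D := by
  apply sum_le_of_disj (pJob z D ι) σ _ 0
  · intro i hi j hj hij
    exact H.disj k (mem_filter.mp hi).2 (mem_filter.mp hj).2 hij
  · simp
  · exact fun i _ => H.leW i

theorem Ctx.load (H : Ctx z D ι σ ρ) {k : ℕ} (hk : k = 1 ∨ k = 2 ∨ k = 3 ∨ k = 4) :
    ∑ j ∈ univ.filter (fun j => k ∈ ρ j), pJob z D ι j = Wval z D := by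
  have h23 := H.load23
  have h2 := H.loadle 2
  have h3 := H.loadle 3
  rcases hk with rfl | rfl | rfl | rfl
  · exact H.load1
  · omega
  · omega
  · exact H.load4

theorem Ctx.mf (H : Ctx z D ι σ ρ) {k : ℕ} (hk : k = 1 ∨ k = 2 ∨ k = 3 ∨ k = 4) (x : Job z)
    (hx : k ∈ ρ x) :
    σ x = ∑ j, if k ∈ ρ j ∧ σ j + pJob z D ι j ≤ σ x then pJob z D ι j else 0 := by
  have := mach_formula (pJob z D ι) σ (univ.filter (fun j => k ∈ ρ j)) (Wval z D)
    (fun i hi j hj hij => H.disj k (mem_filter.mp hi).2 (mem_filter.mp hj).2 hij)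
    (fun i _ => H.leW i) (H.load hk) x (by simpa using hx)
  rw [Finset.sum_filter] at this
  simpa only [← ite_and] using this

/-- count of a class -/
abbrev Ctx.N (_H : Ctx z D ι σ ρ) {n : ℕ} (f : Fin n → Job z) (t : ℕ) : ℕ := cN (pJob z D ι) σ f t
/-- count of a class on a machine -/
abbrev Ctx.K (_H : Ctx z D ι σ ρ) (k : ℕ) {n : ℕ} (f : Fin n → Job z) (t : ℕ) : ℕ :=
  cK (pJob z D ι) σ ρ k f t

abbrev L1 : Fin 1 → Job z := fun _ => .Jl1
abbrev L2 : Fin 1 → Job z := fun _ => .Jl2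

theorem Ctx.f1 (H : Ctx z D ι σ ρ) (x : Job z) (hx : 1 ∈ ρ x) :
    σ x = 0 + H.N .JA (σ x) * D^2 + (H.N .Jα (σ x) + H.N L1 (σ x)) * D^3 + H.N .Ja (σ x) * D^4
      + H.N .Jα (σ x) * D^5 + H.N .Ja (σ x) * D^6
      + (3 * z * H.N .Ja (σ x) + 4 * z * H.N .Jα (σ x) + z * H.N L1 (σ x)) * D^7
      + (H.N .Jα (σ x) + H.N L1 (σ x)) * D^8 := by
  have h := H.mf (Or.inl rfl) x hx
  generalize σ x = t at *
  rw [sum_job] at h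
  simp only [H.m1, M1Jobs, true_and, false_and, if_false, Finset.sum_const_zero] at h
  have e1 := sum_ite_cN (pJob z D ι) σ .JA t (D^2)
  have e2 := sum_ite_cN (pJob z D ι) σ .Ja t (D^4 + D^6 + 3*z*D^7)
  have e3 := sum_ite_cN (pJob z D ι) σ .Jα t (D^3 + D^5 + 4*z*D^7 + D^8)
  have e4 := sum_ite_cN (pJob z D ι) σ L1 t (D^3 + z*D^7 + D^8)
  simp only [pJob] at e1 e2 e3 e4 h
  rw [e1, e2, e3, e4] at h
  refine h.trans ?_
  ring

theorem Ctx.f4 (H : Ctx z D ι σ ρ) (x : Job z) (hx : 4 ∈ ρ x) :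
    σ x = 0 + (H.N .Jβ (σ x) + H.N L2 (σ x)) * D^2 + H.N .JB (σ x) * D^3 + H.N .Jβ (σ x) * D^4
      + H.N .Jb (σ x) * D^5 + H.N .Jb (σ x) * D^6
      + (3 * z * H.N .Jb (σ x) + (4 * z - 1) * H.N .Jβ (σ x) + 2 * z * H.N L2 (σ x)) * D^7
      + (H.N .Jβ (σ x) + H.N L2 (σ x)) * D^8 := by
  have h := H.mf (by simp) x hx
  generalize σ x = t at *
  rw [sum_job] at h
  simp only [H.m4, M4Jobs, true_and, false_and, if_false, Finset.sum_const_zero] at h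
  have e1 := sum_ite_cN (pJob z D ι) σ .JB t (D^3)
  have e2 := sum_ite_cN (pJob z D ι) σ .Jb t (D^5 + D^6 + 3*z*D^7)
  have e3 := sum_ite_cN (pJob z D ι) σ .Jβ t (D^2 + D^4 + (4*z-1)*D^7 + D^8)
  have e4 := sum_ite_cN (pJob z D ι) σ L2 t (D^2 + 2*z*D^7 + D^8)
  simp only [pJob] at e1 e2 e3 e4 h
  rw [e1, e2, e3, e4] at h
  refine h.trans ?_
  generalize 4*z-1 = u
  ring

/-- partition load on machine `k` before `t` -/
def Ctx.P (_H : Ctx z D ι σ ρ) (k t : ℕ) : ℕ :=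
  ∑ i, if k ∈ ρ (.Jpart i) ∧ σ (.Jpart i) + pJob z D ι (.Jpart i) ≤ t then ι i else 0

/-- the coefficient of `D^7` on machine `k` before `t` -/
def Ctx.Q (H : Ctx z D ι σ ρ) (k t : ℕ) : ℕ :=
  (∑ i : Fin (z+1), if σ (.Jc i) + pJob z D ι (.Jc i) ≤ t then (z + i.val) else 0)
  + 3 * z * (H.K k .Ja t + H.K k .Jb t)
  + (∑ i : Fin z, if k ∈ ρ (.Jγ i) ∧ σ (.Jγ i) + pJob z D ι (.Jγ i) ≤ t
      then (3*z - (i.val+1)) else 0)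
  + (∑ i : Fin z, if k ∈ ρ (.Jδ i) ∧ σ (.Jδ i) + pJob z D ι (.Jδ i) ≤ t
      then (3*z - (i.val+1)) else 0)

theorem Ctx.f23 (H : Ctx z D ι σ ρ) {k : ℕ} (hk : k = 2 ∨ k = 3) (x : Job z) (hx : k ∈ ρ x) :
    σ x + D * H.K k .Jγ (σ x) = H.P k (σ x) + H.N .JA (σ x) * D^2 + H.N .JB (σ x) * D^3
      + (H.K k .Ja (σ x) + H.K k .Jδ (σ x)) * D^4
      + (H.K k .Jb (σ x) + H.K k .Jγ (σ x)) * D^5 + (H.K k .Ja (σ x) + H.K k .Jb (σ x)) * D^6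
      + H.Q k (σ x) * D^7 + H.N .Jc (σ x) * D^8 := by
  have h := H.mf (by omega) x hx
  generalize σ x = t at *
  rw [sum_job] at h
  have b1 : ∀ i, k ∈ ρ (.JA i) := fun i => H.both (.JA i) trivial hk
  have b2 : ∀ i, k ∈ ρ (.JB i) := fun i => H.both (.JB i) trivial hk
  have b3 : ∀ i, k ∈ ρ (.Jc i) := fun i => H.both (.Jc i) trivial hk
  have n1 : ∀ i, k ∉ ρ (.Jα i) := fun i => H.none _ rfl hk
  have n2 : ∀ i, k ∉ ρ (.Jβ i) := fun i => H.none _ rfl hk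
  have n3 : k ∉ ρ .Jl1 := H.none _ rfl hk
  have n4 : k ∉ ρ .Jl2 := H.none _ rfl hk
  simp only [b1, b2, b3, n1, n2, n3, n4, true_and, false_and, if_false, Finset.sum_const_zero] at h
  have e1 := sum_ite_cN (pJob z D ι) σ .JA t (D^2)
  have e2 := sum_ite_cN (pJob z D ι) σ .JB t (D^3)
  have e3 := sum_ite_cK (pJob z D ι) σ ρ k .Ja t (D^4 + D^6 + 3*z*D^7)
  have e4 := sum_ite_cK (pJob z D ι) σ ρ k .Jb t (D^5 + D^6 + 3*z*D^7)
  have e5 : (∑ i : Fin (z+1), if σ (.Jc i) + pJob z D ι (.Jc i) ≤ t then pJob z D ι (.Jc i) else 0)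
      = (∑ i : Fin (z+1), if σ (.Jc i) + pJob z D ι (.Jc i) ≤ t then (z + i.val) else 0) * D^7
        + H.N .Jc t * D^8 := by
    rw [← sum_ite_cN, Finset.sum_mul, ← Finset.sum_add_distrib]
    refine Finset.sum_congr rfl fun i _ => ?_
    split_ifs <;> simp [pJob]
  have e6 : (∑ i : Fin z, if k ∈ ρ (.Jδ i) ∧ σ (.Jδ i) + pJob z D ι (.Jδ i) ≤ t
        then pJob z D ι (.Jδ i) else 0)
      = (∑ i : Fin z, if k ∈ ρ (.Jδ i) ∧ σ (.Jδ i) + pJob z D ι (.Jδ i) ≤ t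
        then (3*z - (i.val+1)) else 0) * D^7 + H.K k .Jδ t * D^4 := by
    rw [← sum_ite_cK, Finset.sum_mul, ← Finset.sum_add_distrib]
    refine Finset.sum_congr rfl fun i _ => ?_
    split_ifs
    · simp only [pJob]; ring
    · simp
  have e7 : (∑ i : Fin z, if k ∈ ρ (.Jγ i) ∧ σ (.Jγ i) + pJob z D ι (.Jγ i) ≤ t
        then pJob z D ι (.Jγ i) else 0) + H.K k .Jγ t * D
      = (∑ i : Fin z, if k ∈ ρ (.Jγ i) ∧ σ (.Jγ i) + pJob z D ι (.Jγ i) ≤ t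
        then (3*z - (i.val+1)) else 0) * D^7 + H.K k .Jγ t * D^5 := by
    rw [← sum_ite_cK, ← sum_ite_cK, Finset.sum_mul, ← Finset.sum_add_distrib,
      ← Finset.sum_add_distrib]
    refine Finset.sum_congr rfl fun i _ => ?_
    have := H.pγ i
    split_ifs
    · rw [this]; ring
    · simp
  have e8 : (∑ i, if k ∈ ρ (.Jpart i) ∧ σ (.Jpart i) + pJob z D ι (.Jpart i) ≤ t
      then pJob z D ι (.Jpart i) else 0) = H.P k t := rfl
  rw [e5, e6, e8] at h
  simp only [pJob] at e1 e2 e3 e4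
  simp only [pJob] at h e7
  rw [e1, e2, e3, e4] at h
  simp only [Ctx.Q, pJob]
  zify at h e7 ⊢
  linear_combination h + e7

theorem Ctx.P_le (H : Ctx z D ι σ ρ) (k t : ℕ) : H.P k t ≤ z * D := by
  rw [← H.hsum]
  apply Finset.sum_le_sum
  intro i _
  split_ifs <;> omega

theorem Ctx.Q_le (H : Ctx z D ι σ ρ) (k t : ℕ) : H.Q k t < D := by
  have h1 : (∑ i : Fin (z+1), if σ (.Jc i) + pJob z D ι (.Jc i) ≤ t then (z + i.val) else 0)
      ≤ ∑ _i : Fin (z+1), 2 * z := by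
    apply Finset.sum_le_sum
    intro i _
    split_ifs <;> omega
  have h2 : (∑ i : Fin z, if k ∈ ρ (.Jγ i) ∧ σ (.Jγ i) + pJob z D ι (.Jγ i) ≤ t
      then (3*z - (i.val+1)) else 0) ≤ ∑ _i : Fin z, 3 * z := by
    apply Finset.sum_le_sum
    intro i _
    split_ifs <;> omega
  have h3 : (∑ i : Fin z, if k ∈ ρ (.Jδ i) ∧ σ (.Jδ i) + pJob z D ι (.Jδ i) ≤ t
      then (3*z - (i.val+1)) else 0) ≤ ∑ _i : Fin z, 3 * z := by
    apply Finset.sum_le_sum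
    intro i _
    split_ifs <;> omega
  simp only [Finset.sum_const, Finset.card_univ, Fintype.card_fin, smul_eq_mul] at h1 h2 h3
  have h4 := cK_le (pJob z D ι) σ ρ k .Ja t
  have h5 := cK_le (pJob z D ι) σ ρ k .Jb t
  have h6 : 3 * z * (H.K k .Ja t + H.K k .Jb t) ≤ 3 * z * (z + z) := by gcongr
  have h7 := H.hD
  unfold Ctx.Q
  nlinarith

theorem Ctx.small (H : Ctx z D ι σ ρ) : 14 * z * z + 14 * z + 4 ≤ D + 0 ∧ 2 * z + 2 < D := by
  have h7 := H.hD
  have := H.hz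
  constructor <;> nlinarith

theorem Ctx.fact1 (H : Ctx z D ι σ ρ) {x : Job z} (hx : 1 ∈ ρ x) {k : ℕ} (hk : k = 2 ∨ k = 3)
    (hkx : k ∈ ρ x) :
    H.N .JB (σ x) = H.N .Jα (σ x) + H.N L1 (σ x) ∧ H.N .Jc (σ x) = H.N .JB (σ x) ∧
    H.K k .Ja (σ x) + H.K k .Jδ (σ x) = H.N .Ja (σ x) ∧
    H.K k .Jb (σ x) + H.K k .Jγ (σ x) = H.N .Jα (σ x) ∧
    H.K k .Ja (σ x) + H.K k .Jb (σ x) = H.N .Ja (σ x) ∧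
    H.Q k (σ x) = 3 * z * H.N .Ja (σ x) + 4 * z * H.N .Jα (σ x) + z * H.N L1 (σ x) := by
  have e1 := H.f1 x hx
  have e2 := H.f23 hk x hkx
  have hP := H.P_le k (σ x)
  have hQ := H.Q_le k (σ x)
  generalize σ x = t at *
  have hD := H.hD
  have hs := H.small
  have hz := H.hz
  have b1 := cN_le (pJob z D ι) σ .JA t
  have b2 := cN_le (pJob z D ι) σ .JB t
  have b3 := cN_le (pJob z D ι) σ .Ja t
  have b4 := cN_le (pJob z D ι) σ .Jα t
  have b5 := cN_le (pJob z D ι) σ (L1 (z := z)) t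
  have c1 := cK_le (pJob z D ι) σ ρ k .Ja t
  have c2 := cK_le (pJob z D ι) σ ρ k .Jb t
  have c3 := cK_le (pJob z D ι) σ ρ k .Jγ t
  have c4 := cK_le (pJob z D ι) σ ρ k .Jδ t
  have hQ' : 3 * z * H.N .Ja t + 4 * z * H.N .Jα t + z * H.N L1 t < D := by
    have : 3 * z * H.N .Ja t + 4 * z * H.N .Jα t + z * H.N L1 t ≤ 3 * z * z + 4 * z * z + z * 1 := by
      gcongr
    nlinarith
  have hX : D * H.K k .Jγ t < D * D := by
    have : H.K k .Jγ t < D := by simp only [Ctx.K]; omega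
    exact Nat.mul_lt_mul_of_pos_left this (by omega)
  have hY : H.P k t < D * D := lt_of_le_of_lt hP (Nat.mul_lt_mul_of_pos_right (by omega) (by omega))
  have := digits D (D * H.K k .Jγ t) (H.P k t) (H.N .JA t) (H.N .Jα t + H.N L1 t) (H.N .Ja t)
    (H.N .Jα t) (H.N .Ja t) (3 * z * H.N .Ja t + 4 * z * H.N .Jα t + z * H.N L1 t)
    (H.N .Jα t + H.N L1 t) (H.N .JA t) (H.N .JB t) (H.K k .Ja t + H.K k .Jδ t)
    (H.K k .Jb t + H.K k .Jγ t) (H.K k .Ja t + H.K k .Jb t) (H.Q k t) (H.N .Jc t) hX hY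
    (by simp only [Ctx.N]; omega) (by simp only [Ctx.N]; omega) (by simp only [Ctx.N]; omega)
    (by simp only [Ctx.N]; omega) (by simp only [Ctx.N]; omega) hQ'
    (by simp only [Ctx.N]; omega) (by simp only [Ctx.N]; omega) (by simp only [Ctx.K]; omega)
    (by simp only [Ctx.K]; omega) (by simp only [Ctx.K]; omega) hQ (by omega)
  obtain ⟨-, h2, h3, h4, h5, h6, h7, h8⟩ := this
  refine ⟨h3.symm, ?_, h4.symm, h5.symm, h6.symm, h7.symm⟩
  omega

theorem Ctx.fact4 (H : Ctx z D ι σ ρ) {x : Job z} (hx : 4 ∈ ρ x) {k : ℕ} (hk : k = 2 ∨ k = 3)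
    (hkx : k ∈ ρ x) :
    H.N .JA (σ x) = H.N .Jβ (σ x) + H.N L2 (σ x) ∧ H.N .Jc (σ x) = H.N .JA (σ x) ∧
    H.K k .Ja (σ x) + H.K k .Jδ (σ x) = H.N .Jβ (σ x) ∧
    H.K k .Jb (σ x) + H.K k .Jγ (σ x) = H.N .Jb (σ x) ∧
    H.K k .Ja (σ x) + H.K k .Jb (σ x) = H.N .Jb (σ x) ∧
    H.Q k (σ x) = 3 * z * H.N .Jb (σ x) + (4 * z - 1) * H.N .Jβ (σ x) + 2 * z * H.N L2 (σ x) := by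
  have e1 := H.f4 x hx
  have e2 := H.f23 hk x hkx
  have hP := H.P_le k (σ x)
  have hQ := H.Q_le k (σ x)
  generalize σ x = t at *
  have hD := H.hD
  have hs := H.small
  have hz := H.hz
  have b1 := cN_le (pJob z D ι) σ .JA t
  have b2 := cN_le (pJob z D ι) σ .JB t
  have b3 := cN_le (pJob z D ι) σ .Jb t
  have b4 := cN_le (pJob z D ι) σ .Jβ t
  have b5 := cN_le (pJob z D ι) σ (L2 (z := z)) t
  have c1 := cK_le (pJob z D ι) σ ρ k .Ja t
  have c2 := cK_le (pJob z D ι) σ ρ k .Jb t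
  have c3 := cK_le (pJob z D ι) σ ρ k .Jγ t
  have c4 := cK_le (pJob z D ι) σ ρ k .Jδ t
  have hQ' : 3 * z * H.N .Jb t + (4 * z - 1) * H.N .Jβ t + 2 * z * H.N L2 t < D := by
    have : 3 * z * H.N .Jb t + (4 * z - 1) * H.N .Jβ t + 2 * z * H.N L2 t
        ≤ 3 * z * z + (4 * z) * z + 2 * z * 1 := by
      gcongr
      omega
    nlinarith
  have hX : D * H.K k .Jγ t < D * D := by
    have : H.K k .Jγ t < D := by simp only [Ctx.K]; omega
    exact Nat.mul_lt_mul_of_pos_left this (by omega)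
  have hY : H.P k t < D * D := lt_of_le_of_lt hP (Nat.mul_lt_mul_of_pos_right (by omega) (by omega))
  have := digits D (D * H.K k .Jγ t) (H.P k t) (H.N .Jβ t + H.N L2 t) (H.N .JB t) (H.N .Jβ t)
    (H.N .Jb t) (H.N .Jb t) (3 * z * H.N .Jb t + (4 * z - 1) * H.N .Jβ t + 2 * z * H.N L2 t)
    (H.N .Jβ t + H.N L2 t) (H.N .JA t) (H.N .JB t) (H.K k .Ja t + H.K k .Jδ t)
    (H.K k .Jb t + H.K k .Jγ t) (H.K k .Ja t + H.K k .Jb t) (H.Q k t) (H.N .Jc t) hX hY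
    (by simp only [Ctx.N]; omega) (by simp only [Ctx.N]; omega) (by simp only [Ctx.N]; omega)
    (by simp only [Ctx.N]; omega) (by simp only [Ctx.N]; omega) hQ'
    (by simp only [Ctx.N]; omega) (by simp only [Ctx.N]; omega) (by simp only [Ctx.K]; omega)
    (by simp only [Ctx.K]; omega) (by simp only [Ctx.K]; omega) hQ (by omega)
  obtain ⟨-, h2, h3, h4, h5, h6, h7, h8⟩ := this
  refine ⟨h2.symm, ?_, h4.symm, h5.symm, h6.symm, h7.symm⟩
  omega

theorem Ctx.fact23 (H : Ctx z D ι σ ρ) {x : Job z} (hx2 : 2 ∈ ρ x) (hx3 : 3 ∈ ρ x) :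
    H.K 2 .Ja (σ x) + H.K 2 .Jb (σ x) = H.K 3 .Ja (σ x) + H.K 3 .Jb (σ x) := by
  have e1 := H.f23 (Or.inl rfl) x hx2
  have e2 := H.f23 (Or.inr rfl) x hx3
  have hP := H.P_le 2 (σ x)
  have hQ := H.Q_le 2 (σ x)
  have hP3 := H.P_le 3 (σ x)
  have hQ3 := H.Q_le 3 (σ x)
  generalize σ x = t at *
  have hD := H.hD
  have hs := H.small
  have hz := H.hz
  have b1 := cN_le (pJob z D ι) σ .JA t
  have b2 := cN_le (pJob z D ι) σ .JB t
  have c1 := fun k => cK_le (pJob z D ι) σ ρ k .Ja t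
  have c2 := fun k => cK_le (pJob z D ι) σ ρ k .Jb t
  have c3 := fun k => cK_le (pJob z D ι) σ ρ k .Jγ t
  have c4 := fun k => cK_le (pJob z D ι) σ ρ k .Jδ t
  have hX : ∀ k l, H.P l t ≤ z * D → D * H.K k .Jγ t + H.P l t < D * D := by
    intro k l h
    have h1 : D * H.K k .Jγ t ≤ D * z := Nat.mul_le_mul_left D (c3 k)
    have h2 : D * (2 * z) < D * D := Nat.mul_lt_mul_of_pos_left (by omega) (by omega)
    nlinarith
  have := digits D (D * H.K 3 .Jγ t + H.P 2 t) (D * H.K 2 .Jγ t + H.P 3 t) (H.N .JA t) (H.N .JB t)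
    (H.K 2 .Ja t + H.K 2 .Jδ t)
    (H.K 2 .Jb t + H.K 2 .Jγ t) (H.K 2 .Ja t + H.K 2 .Jb t) (H.Q 2 t) (H.N .Jc t)
    (H.N .JA t) (H.N .JB t) (H.K 3 .Ja t + H.K 3 .Jδ t)
    (H.K 3 .Jb t + H.K 3 .Jγ t) (H.K 3 .Ja t + H.K 3 .Jb t) (H.Q 3 t) (H.N .Jc t)
    (hX 3 2 hP) (hX 2 3 hP3)
  have d1 := c1 2
  have d2 := c2 2
  have d3 := c3 2
  have d4 := c4 2
  have d5 := c1 3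
  have d6 := c2 3
  have d7 := c3 3
  have d8 := c4 3
  have := this
    (by simp only [Ctx.N]; omega) (by simp only [Ctx.N]; omega) (by simp only [Ctx.K]; omega)
    (by simp only [Ctx.K]; omega) (by simp only [Ctx.K]; omega) hQ
    (by simp only [Ctx.N]; omega) (by simp only [Ctx.N]; omega) (by simp only [Ctx.K]; omega)
    (by simp only [Ctx.K]; omega) (by simp only [Ctx.K]; omega) hQ3 (by omega)
  exact this.2.2.2.2.2.1

theorem Ctx.split (H : Ctx z D ι σ ρ) {n : ℕ} (f : Fin n → Job z) (hf : ∀ i, OneM23 (f i)) (t : ℕ) :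
    H.N f t = H.K 2 f t + H.K 3 f t := by
  simp only [Ctx.N, Ctx.K, cN, cK]
  rw [← Finset.card_union_of_disjoint]
  · congr 1
    ext i
    have := H.hnf.2.2.2 (f i) (hf i)
    simp only [mem_filter, mem_univ, true_and, mem_union]
    tauto
  · rw [Finset.disjoint_left]
    intro i
    have := H.hnf.2.2.2 (f i) (hf i)
    simp only [mem_filter, mem_univ, true_and]
    tauto

theorem Ctx.splits (H : Ctx z D ι σ ρ) (t : ℕ) :
    H.N .Ja t = H.K 2 .Ja t + H.K 3 .Ja t ∧ H.N .Jb t = H.K 2 .Jb t + H.K 3 .Jb t ∧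
    H.N .Jγ t = H.K 2 .Jγ t + H.K 3 .Jγ t ∧ H.N .Jδ t = H.K 2 .Jδ t + H.K 3 .Jδ t :=
  ⟨H.split Job.Ja (fun _ => trivial) t, H.split Job.Jb (fun _ => trivial) t,
    H.split Job.Jγ (fun _ => trivial) t, H.split Job.Jδ (fun _ => trivial) t⟩

theorem Ctx.chain (H : Ctx z D ι σ ρ) (k : ℕ) {n : ℕ} (f : Fin n → Job z) (hk : ∀ i, k ∈ ρ (f i))
    (hf : Function.Injective f) : Chain (pJob z D ι) σ f :=
  fun i j hij => H.disj k (hk i) (hk j) fun h => hij (hf h)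

theorem Ctx.later (H : Ctx z D ι σ ρ) (k : ℕ) {n : ℕ} {f : Fin n → Job z} {x : Job z} {y : Fin n}
    (hx : k ∈ ρ x) (hy : k ∈ ρ (f y)) (hne : x ≠ f y)
    (h : H.N f (σ x) ≤ H.N f (σ (f y))) : σ x + pJob z D ι x ≤ σ (f y) := by
  rcases H.disj k hx hy hne with h' | h'
  · exact h'
  · have := cN_lt (pJob z D ι) σ f y (s := σ (f y)) (by have := H.ppos (f y); omega) h'
    simp only [Ctx.N] at h
    omega

theorem Ctx.excl (H : Ctx z D ι σ ρ) {k k' : ℕ} (hkk : k = 2 ∧ k' = 3 ∨ k = 3 ∧ k' = 2) (m : ℕ)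
    (f g : Fin z → Job z) (hf : ∀ i, m ∈ ρ (f i)) (hfo : ∀ i, OneM23 (f i))
    (hgo : ∀ i, OneM23 (g i)) (u : Job z) (hu : m ∈ ρ u) (hune : ∀ i, u ≠ f i)
    (hfact : ∀ w, k' ∈ ρ (f w) →
      H.K k' g (σ (f w)) + H.K k' f (σ (f w)) = H.N f (σ (f w)))
    (y : Fin z) (hk : k ∈ ρ (f y)) (hN : H.N f (σ (f y)) = H.N f (σ u)) (huy : σ u ≤ σ (f y))
    {C : ℕ} (hT : H.K k' g (σ u) = H.K k f (σ u))
    (hg : H.N g C = H.N g (σ u)) (hff : H.K k' f (σ u) < H.K k' f C) : False := by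
  obtain ⟨w, hw1, hw2, hw3⟩ := cK_ex _ _ _ _ _ hff
  have hne : f y ≠ f w := by
    intro h
    have := H.hnf.2.2.2 (f y) (hfo y)
    rw [← h] at hw1
    rcases hkk with ⟨rfl, rfl⟩ | ⟨rfl, rfl⟩ <;> tauto
  have hpw := H.ppos (f w)
  have hpy := H.ppos (f y)
  have huw : σ u ≤ σ (f w) := by
    rcases H.disj m hu (hf w) (hune w) with h | h <;> omega
  have hfa := hfact w hw1
  rcases H.disj m (hf y) (hf w) hne with h | h
  · have h1 := cK_lt (pJob z D ι) σ ρ k f y hk (s := σ u) (t := σ (f w)) (by omega) h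
    have h2 := cK_mono (pJob z D ι) σ ρ 2 g huw
    have h3 := cK_mono (pJob z D ι) σ ρ 3 g huw
    have h4 := cK_mono (pJob z D ι) σ ρ 2 g (by omega : σ (f w) ≤ C)
    have h5 := cK_mono (pJob z D ι) σ ρ 3 g (by omega : σ (f w) ≤ C)
    have h6 := H.split g hgo C
    have h7 := H.split g hgo (σ u)
    have h8 := H.split f hfo (σ (f w))
    simp only [Ctx.N, Ctx.K] at *
    rcases hkk with ⟨rfl, rfl⟩ | ⟨rfl, rfl⟩ <;> omega
  · have := cN_lt (pJob z D ι) σ f w (s := σ u) (t := σ (f y)) (by omega) h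
    simp only [Ctx.N] at hN
    omega

attribute [local irreducible] cN cK pJob

theorem Ctx.fa1 (H : Ctx z D ι σ ρ) {x : Job z} (hx : 1 ∈ ρ x) {k : ℕ} (hk : k = 2 ∨ k = 3)
    (hkx : k ∈ ρ x) :
    H.N .JB (σ x) = H.N .Jα (σ x) + H.N L1 (σ x) ∧ H.N .Jc (σ x) = H.N .JB (σ x) ∧
    H.K k .Ja (σ x) + H.K k .Jδ (σ x) = H.N .Ja (σ x) ∧
    H.K k .Jb (σ x) + H.K k .Jγ (σ x) = H.N .Jα (σ x) ∧
    H.K k .Ja (σ x) + H.K k .Jb (σ x) = H.N .Ja (σ x) := by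
  obtain ⟨h1, h2, h3, h4, h5, -⟩ := H.fact1 hx hk hkx
  exact ⟨h1, h2, h3, h4, h5⟩

theorem Ctx.fa4 (H : Ctx z D ι σ ρ) {x : Job z} (hx : 4 ∈ ρ x) {k : ℕ} (hk : k = 2 ∨ k = 3)
    (hkx : k ∈ ρ x) :
    H.N .JA (σ x) = H.N .Jβ (σ x) + H.N L2 (σ x) ∧ H.N .Jc (σ x) = H.N .JA (σ x) ∧
    H.K k .Ja (σ x) + H.K k .Jδ (σ x) = H.N .Jβ (σ x) ∧
    H.K k .Jb (σ x) + H.K k .Jγ (σ x) = H.N .Jb (σ x) ∧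
    H.K k .Ja (σ x) + H.K k .Jb (σ x) = H.N .Jb (σ x) := by
  obtain ⟨h1, h2, h3, h4, h5, -⟩ := H.fact4 hx hk hkx
  exact ⟨h1, h2, h3, h4, h5⟩

theorem Ctx.Nm (H : Ctx z D ι σ ρ) {n : ℕ} (f : Fin n → Job z) {s t : ℕ} (h : s ≤ t) :
    H.N f s ≤ H.N f t := cN_mono _ _ _ h

theorem Ctx.Km (H : Ctx z D ι σ ρ) (k : ℕ) {n : ℕ} (f : Fin n → Job z) {s t : ℕ} (h : s ≤ t) :
    H.K k f s ≤ H.K k f t := cK_mono _ _ _ _ _ h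

theorem Ctx.Km2 (H : Ctx z D ι σ ρ) {s t : ℕ} (h : s ≤ t) :
    (H.K 2 .Ja s ≤ H.K 2 .Ja t ∧ H.K 2 .Jb s ≤ H.K 2 .Jb t ∧ H.K 2 .Jγ s ≤ H.K 2 .Jγ t ∧
    H.K 2 .Jδ s ≤ H.K 2 .Jδ t) ∧ (H.K 3 .Ja s ≤ H.K 3 .Ja t ∧ H.K 3 .Jb s ≤ H.K 3 .Jb t ∧
    H.K 3 .Jγ s ≤ H.K 3 .Jγ t ∧ H.K 3 .Jδ s ≤ H.K 3 .Jδ t) :=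
  ⟨⟨H.Km _ _ h, H.Km _ _ h, H.Km _ _ h, H.Km _ _ h⟩, ⟨H.Km _ _ h, H.Km _ _ h, H.Km _ _ h, H.Km _ _ h⟩⟩

theorem Ctx.ended (H : Ctx z D ι σ ρ) {n : ℕ} (f : Fin n → Job z) (y : Fin n) {t : ℕ}
    (h : σ (f y) + pJob z D ι (f y) ≤ t) : H.N f (σ (f y)) + 1 ≤ H.N f t :=
  cN_lt _ _ _ y (by have := H.ppos (f y); omega) h

theorem Ctx.chA (H : Ctx z D ι σ ρ) : Chain (pJob z D ι) σ Job.JA :=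
  H.chain 1 _ (fun i => (H.m1 (Job.JA i)).2 trivial) (fun _ _ h => Job.JA.inj h)
theorem Ctx.chB (H : Ctx z D ι σ ρ) : Chain (pJob z D ι) σ Job.JB :=
  H.chain 4 _ (fun i => (H.m4 (Job.JB i)).2 trivial) (fun _ _ h => Job.JB.inj h)
theorem Ctx.cha (H : Ctx z D ι σ ρ) : Chain (pJob z D ι) σ Job.Ja :=
  H.chain 1 _ (fun i => (H.m1 (Job.Ja i)).2 trivial) (fun _ _ h => Job.Ja.inj h)
theorem Ctx.chb (H : Ctx z D ι σ ρ) : Chain (pJob z D ι) σ Job.Jb :=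
  H.chain 4 _ (fun i => (H.m4 (Job.Jb i)).2 trivial) (fun _ _ h => Job.Jb.inj h)
theorem Ctx.chβ (H : Ctx z D ι σ ρ) : Chain (pJob z D ι) σ Job.Jβ :=
  H.chain 4 _ (fun i => (H.m4 (Job.Jβ i)).2 trivial) (fun _ _ h => Job.Jβ.inj h)
theorem Ctx.chc (H : Ctx z D ι σ ρ) : Chain (pJob z D ι) σ Job.Jc :=
  H.chain 2 _ (fun i => H.both (Job.Jc i) trivial (Or.inl rfl)) (fun _ _ h => Job.Jc.inj h)

theorem Ctx.nth (H : Ctx z D ι σ ρ) {n : ℕ} {f : Fin n → Job z} (hf : Chain (pJob z D ι) σ f)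
    {i : ℕ} (hi : i < n) : ∃ y, H.N f (σ (f y)) = i := nth_ex _ _ H.ppos f hf i hi

theorem Ctx.ends (H : Ctx z D ι σ ρ) {n : ℕ} {f : Fin n → Job z} (hf : Chain (pJob z D ι) σ f)
    {y : Fin n} {t : ℕ} (h : H.N f (σ (f y)) < H.N f t) : σ (f y) + pJob z D ι (f y) ≤ t :=
  (nth_iff _ _ H.ppos f hf y t).2 h

theorem Ctx.mach (H : Ctx z D ι σ ρ) (x : Job z) (h : OneM23 x) :
    ∃ k k', (k = 2 ∧ k' = 3 ∨ k = 3 ∧ k' = 2) ∧ k ∈ ρ x := by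
  have := H.hnf.2.2.2 x h
  by_cases h2 : 2 ∈ ρ x
  · exact ⟨2, 3, Or.inl ⟨rfl, rfl⟩, h2⟩
  · exact ⟨3, 2, Or.inr ⟨rfl, rfl⟩, by tauto⟩

theorem arith1 {i a b a' b' a2 a3 b2 b3 a2' a3' b2' b3' : ℕ} (hab : a = b)
    (h1 : a2 + b2 = i) (h2 : a3 + b3 = i) (h3 : a = a2 + a3) (h4 : b = b2 + b3)
    (h5 : a' = a2' + a3') (h6 : b' = b2' + b3') (h7 : a2' + b2' = a3' + b3') (h8 : a2 ≤ a2')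
    (h9 : a3 ≤ a3') (h10 : a = a') (h11 : b < b') :
    a3 = b2 ∧ a2 = b3 ∧ b2 < b2' ∧ b3 < b3' := by
  omega

theorem arith2 {i B c α l a b γ δ a2 a3 b2 b3 γ2 γ3 δ2 δ3 : ℕ}
    (h1 : B = α + l ∧ c = B ∧ a2 + δ2 = a ∧ b2 + γ2 = α ∧ a2 + b2 = a)
    (h2 : B = α + l ∧ c = B ∧ a3 + δ3 = a ∧ b3 + γ3 = α ∧ a3 + b3 = a)
    (h3 : a = a2 + a3 ∧ b = b2 + b3 ∧ γ = γ2 + γ3 ∧ δ = δ2 + δ3) (h4 : l ≤ 1) (h5 : α ≤ i)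
    (h6 : b = i) (h7 : i + 1 ≤ B) :
    B = i + 1 ∧ c = i + 1 ∧ α = i ∧ l = 1 ∧ a = i ∧ b = i ∧ γ = i ∧ δ = i := by
  omega

/-- the state at the start of the `i`th `B` job -/
structure St (H : Ctx z D ι σ ρ) (i t : ℕ) : Prop where
  A : H.N .JA t = i
  B : H.N .JB t = i
  c : H.N .Jc t = i
  β : H.N .Jβ t = i
  l : H.N L2 t = 0
  a : H.N .Ja t = i
  b : H.N .Jb t = i
  γ : H.N .Jγ t = i
  δ : H.N .Jδ t = i

theorem Ctx.afterA (H : Ctx z D ι σ ρ) {i : ℕ} {x : Fin (z+1)} (h : St H i (σ (.JB x)))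
    {y : Fin (z+1)} (hy : H.N .JA (σ (.JA y)) = i) :
    σ (.JB x) + pJob z D ι (.JB x) ≤ σ (.JA y) ∧ i + 1 ≤ H.N .JB (σ (.JA y)) := by
  have h1 := H.later 2 (x := .JB x) (f := Job.JA) (y := y) (H.both (.JB x) trivial (Or.inl rfl))
    (H.both (.JA y) trivial (Or.inl rfl)) (by simp) (by rw [h.A, hy])
  have h2 := H.ended .JB x h1
  rw [h.B] at h2
  exact ⟨h1, h2⟩

theorem Ctx.aftera (H : Ctx z D ι σ ρ) {i : ℕ} {x : Fin (z+1)} (h : St H i (σ (.JB x)))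
    {y : Fin z} (hy : H.N .Ja (σ (.Ja y)) = i) :
    σ (.JB x) + pJob z D ι (.JB x) ≤ σ (.Ja y) ∧ i + 1 ≤ H.N .JB (σ (.Ja y)) := by
  obtain ⟨k, k', hk, hky⟩ := H.mach (.Ja y) trivial
  have h1 := H.later k (x := .JB x) (f := Job.Ja) (y := y) (H.both (.JB x) trivial (by omega))
    hky (by simp) (by rw [h.a, hy])
  have h2 := H.ended .JB x h1
  rw [h.B] at h2
  exact ⟨h1, h2⟩

theorem Ctx.afterb (H : Ctx z D ι σ ρ) {i : ℕ} {x : Fin (z+1)} (h : St H i (σ (.JB x)))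
    {y : Fin z} (hy : H.N .Jb (σ (.Jb y)) = i) :
    σ (.JB x) + pJob z D ι (.JB x) ≤ σ (.Jb y) ∧ i + 1 ≤ H.N .JB (σ (.Jb y)) := by
  have h1 := H.later 4 (x := .JB x) (f := Job.Jb) (y := y) ((H.m4 _).2 trivial)
    ((H.m4 _).2 trivial) (by simp) (by rw [h.b, hy])
  have h2 := H.ended .JB x h1
  rw [h.B] at h2
  exact ⟨h1, h2⟩

theorem Ctx.afterβ (H : Ctx z D ι σ ρ) {i : ℕ} {x : Fin (z+1)} (h : St H i (σ (.JB x)))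
    {y : Fin z} (hy : H.N .Jβ (σ (.Jβ y)) = i) :
    σ (.JB x) + pJob z D ι (.JB x) ≤ σ (.Jβ y) ∧ i + 1 ≤ H.N .JB (σ (.Jβ y)) := by
  have h1 := H.later 4 (x := .JB x) (f := Job.Jβ) (y := y) ((H.m4 _).2 trivial)
    ((H.m4 _).2 trivial) (by simp) (by rw [h.β, hy])
  have h2 := H.ended .JB x h1
  rw [h.B] at h2
  exact ⟨h1, h2⟩

set_option maxHeartbeats 1000000 in
theorem Ctx.claim1 (H : Ctx z D ι σ ρ) {i : ℕ} (hi : i < z) {x : Fin (z+1)}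
    (h : St H i (σ (.JB x))) {yb : Fin z} (hyb : H.N .Jb (σ (.Jb yb)) = i) :
    i + 1 ≤ H.N .JA (σ (.Jb yb)) := by
  by_contra hlt
  obtain ⟨k, k', hkk, hky⟩ := H.mach (.Jb yb) trivial
  have hk23 : k = 2 ∨ k = 3 := by omega
  have h1 := (H.afterb h hyb).1
  have h2 := H.Nm .JA (by omega : σ (.JB x) ≤ σ (.Jb yb))
  have hA := h.A
  have f1 := H.fa4 (x := .Jb yb) ((H.m4 _).2 trivial) hk23 hky
  obtain ⟨yc, hyc⟩ := H.nth H.chc (by omega : i < z + 1)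
  have h3 := H.later k (x := .Jb yb) (f := Job.Jc) (y := yc) hky (H.both (.Jc yc) trivial hk23)
    (by simp) (by omega)
  obtain ⟨ya, hya⟩ := H.nth H.cha hi
  have h4 := H.aftera h hya
  obtain ⟨ka, ka', hka, hkya⟩ := H.mach (.Ja ya) trivial
  have f2 := H.fa1 (x := .Ja ya) ((H.m1 _).2 trivial) (by omega) hkya
  have h5 := H.ends H.chc (y := yc) (t := σ (.Ja ya)) (by omega)
  have hg := H.Nm .Ja (by omega : σ (.Jc yc) ≤ σ (.Ja ya))
  have hg' := H.Nm .Ja (by omega : σ (.JB x) ≤ σ (.Jc yc))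
  have ha := h.a
  have hb := h.b
  have hβ := h.β
  have e := H.ended .Jb yb h3
  have q0 : H.N .Ja (σ (.JB x)) = H.N .Jb (σ (.JB x)) := by omega
  have q1 : H.N .Ja (σ (.JB x)) = H.N .Ja (σ (.Jc yc)) := by omega
  have q2 : H.N .Jb (σ (.JB x)) < H.N .Jb (σ (.Jc yc)) := by omega
  have q3 : H.N .Jb (σ (.Jb yb)) = H.N .Jb (σ (.JB x)) := by omega
  have q4 : σ (.JB x) ≤ σ (.Jb yb) := by omega
  have q5 : σ (.JB x) ≤ σ (.Jc yc) := by omega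
  have hk23' : k' = 2 ∨ k' = 3 := by omega
  have f3 := H.fact23 (x := .Jc yc) (H.both (.Jc yc) trivial (Or.inl rfl))
    (H.both (.Jc yc) trivial (Or.inr rfl))
  have f4 := H.fa4 (x := .JB x) ((H.m4 _).2 trivial) (Or.inl rfl) (H.both (.JB x) trivial (Or.inl rfl))
  have f5 := H.fa4 (x := .JB x) ((H.m4 _).2 trivial) (Or.inr rfl) (H.both (.JB x) trivial (Or.inr rfl))
  have s1 := H.splits (σ (.JB x))
  have s2 := H.splits (σ (.Jc yc))
  have m := H.Km2 q5
  have ar1 := arith1 q0 f4.2.2.2.2 f5.2.2.2.2 s1.1 s1.2.1 s2.1 s2.2.1 f3 m.1.1 m.2.1 q1 q2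
  refine H.excl hkk 4 Job.Jb Job.Ja (fun _ => (H.m4 _).2 trivial) (fun _ => trivial)
    (fun _ => trivial) (.JB x) ((H.m4 _).2 trivial) (fun _ => by simp) ?_ yb hky q3 q4
    (C := σ (.Jc yc)) ?_ q1.symm ?_
  · intro w hw
    exact (H.fa4 (x := .Jb w) ((H.m4 _).2 trivial) hk23' hw).2.2.2.2
  · rcases hkk with ⟨rfl, rfl⟩ | ⟨rfl, rfl⟩
    · exact ar1.1
    · exact ar1.2.1
  · rcases hkk with ⟨rfl, rfl⟩ | ⟨rfl, rfl⟩
    · exact ar1.2.2.2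
    · exact ar1.2.2.1

set_option maxHeartbeats 1000000 in
theorem Ctx.claim2 (H : Ctx z D ι σ ρ) {i : ℕ} (hi : i < z) {x : Fin (z+1)}
    (h : St H i (σ (.JB x))) {s : Fin (z+1)} (hs : H.N .JA (σ (.JA s)) = i) :
    H.N .JB (σ (.JA s)) = i + 1 ∧ H.N .Jc (σ (.JA s)) = i + 1 ∧ H.N .Jα (σ (.JA s)) = i ∧
    H.N L1 (σ (.JA s)) = 1 ∧ H.N .Ja (σ (.JA s)) = i ∧ H.N .Jb (σ (.JA s)) = i ∧
    H.N .Jγ (σ (.JA s)) = i ∧ H.N .Jδ (σ (.JA s)) = i := by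
  obtain ⟨yb, hyb⟩ := H.nth H.chb hi
  have h1 := H.claim1 hi h hyb
  have h2 := H.ends H.chA (y := s) (t := σ (.Jb yb)) (by omega)
  have h3 := H.afterA h hs
  have m1 := H.Nm .Jb (by omega : σ (.JB x) ≤ σ (.JA s))
  have m2 := H.Nm .Jb (by omega : σ (.JA s) ≤ σ (.Jb yb))
  have hb := h.b
  have q0 : H.N .Jb (σ (.JA s)) = i := by omega
  have q1 : σ (.JA s) ≤ σ (.Jb yb) := by omega
  have q2 := h3.2
  clear m1 m2 h1 h2 h3
  obtain ⟨k, k', hkk, hky⟩ := H.mach (.Jb yb) trivial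
  have hk23 : k = 2 ∨ k = 3 := by omega
  have f1 := (H.fa4 (x := .Jb yb) ((H.m4 _).2 trivial) hk23 hky).2.2.2.1
  have f4 := H.fa1 (x := .JA s) ((H.m1 _).2 trivial) (Or.inl rfl) (H.both (.JA s) trivial (Or.inl rfl))
  have f5 := H.fa1 (x := .JA s) ((H.m1 _).2 trivial) (Or.inr rfl) (H.both (.JA s) trivial (Or.inr rfl))
  have s1 := H.splits (σ (.JA s))
  have m1 := H.Km k Job.Jb q1
  have m2 := H.Km k Job.Jγ q1
  have hL : H.N L1 (σ (.JA s)) ≤ 1 := cN_le _ _ _ _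
  have m3 : H.N .Jα (σ (.JA s)) ≤ i := by
    rw [hyb] at f1
    rcases hkk with ⟨rfl, rfl⟩ | ⟨rfl, rfl⟩
    · have := f4.2.2.2.1; omega
    · have := f5.2.2.2.1; omega
  clear m1 m2 f1 hky
  exact arith2 f4 f5 s1 hL m3 q0 q2

theorem Ctx.fA2 (H : Ctx z D ι σ ρ) (s : Fin (z+1)) :
    H.N .JB (σ (.JA s)) = H.N .Jα (σ (.JA s)) + H.N L1 (σ (.JA s)) ∧ H.N .Jc (σ (.JA s)) = H.N .JB (σ (.JA s)) ∧
    H.K 2 .Ja (σ (.JA s)) + H.K 2 .Jδ (σ (.JA s)) = H.N .Ja (σ (.JA s)) ∧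
    H.K 2 .Jb (σ (.JA s)) + H.K 2 .Jγ (σ (.JA s)) = H.N .Jα (σ (.JA s)) ∧
    H.K 2 .Ja (σ (.JA s)) + H.K 2 .Jb (σ (.JA s)) = H.N .Ja (σ (.JA s)) :=
  H.fa1 ((H.m1 (.JA s)).2 trivial) (Or.inl rfl) (H.both (.JA s) trivial (Or.inl rfl))

theorem Ctx.fA3 (H : Ctx z D ι σ ρ) (s : Fin (z+1)) :
    H.N .JB (σ (.JA s)) = H.N .Jα (σ (.JA s)) + H.N L1 (σ (.JA s)) ∧ H.N .Jc (σ (.JA s)) = H.N .JB (σ (.JA s)) ∧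
    H.K 3 .Ja (σ (.JA s)) + H.K 3 .Jδ (σ (.JA s)) = H.N .Ja (σ (.JA s)) ∧
    H.K 3 .Jb (σ (.JA s)) + H.K 3 .Jγ (σ (.JA s)) = H.N .Jα (σ (.JA s)) ∧
    H.K 3 .Ja (σ (.JA s)) + H.K 3 .Jb (σ (.JA s)) = H.N .Ja (σ (.JA s)) :=
  H.fa1 ((H.m1 (.JA s)).2 trivial) (Or.inr rfl) (H.both (.JA s) trivial (Or.inr rfl))

theorem Ctx.fB2 (H : Ctx z D ι σ ρ) (s : Fin (z+1)) :
    H.N .JA (σ (.JB s)) = H.N .Jβ (σ (.JB s)) + H.N L2 (σ (.JB s)) ∧ H.N .Jc (σ (.JB s)) = H.N .JA (σ (.JB s)) ∧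
    H.K 2 .Ja (σ (.JB s)) + H.K 2 .Jδ (σ (.JB s)) = H.N .Jβ (σ (.JB s)) ∧
    H.K 2 .Jb (σ (.JB s)) + H.K 2 .Jγ (σ (.JB s)) = H.N .Jb (σ (.JB s)) ∧
    H.K 2 .Ja (σ (.JB s)) + H.K 2 .Jb (σ (.JB s)) = H.N .Jb (σ (.JB s)) :=
  H.fa4 ((H.m4 (.JB s)).2 trivial) (Or.inl rfl) (H.both (.JB s) trivial (Or.inl rfl))

theorem Ctx.fB3 (H : Ctx z D ι σ ρ) (s : Fin (z+1)) :
    H.N .JA (σ (.JB s)) = H.N .Jβ (σ (.JB s)) + H.N L2 (σ (.JB s)) ∧ H.N .Jc (σ (.JB s)) = H.N .JA (σ (.JB s)) ∧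
    H.K 3 .Ja (σ (.JB s)) + H.K 3 .Jδ (σ (.JB s)) = H.N .Jβ (σ (.JB s)) ∧
    H.K 3 .Jb (σ (.JB s)) + H.K 3 .Jγ (σ (.JB s)) = H.N .Jb (σ (.JB s)) ∧
    H.K 3 .Ja (σ (.JB s)) + H.K 3 .Jb (σ (.JB s)) = H.N .Jb (σ (.JB s)) :=
  H.fa4 ((H.m4 (.JB s)).2 trivial) (Or.inr rfl) (H.both (.JB s) trivial (Or.inr rfl))

theorem Ctx.claim3a (H : Ctx z D ι σ ρ) {i : ℕ} (hi : i < z) {x x' s : Fin (z+1)}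
    (h : St H i (σ (.JB x))) (hs : H.N .JA (σ (.JA s)) = i) (hx' : H.N .JB (σ (.JB x')) = i + 1) :
    σ (.JA s) + pJob z D ι (.JA s) ≤ σ (.JB x') := by
  have h1 := H.claim2 hi h hs
  exact H.later 2 (x := .JA s) (f := Job.JB) (y := x') (H.both (.JA s) trivial (Or.inl rfl))
    (H.both (.JB x') trivial (Or.inl rfl)) (by simp) (by rw [h1.1, hx'])

theorem Ctx.claim3b (H : Ctx z D ι σ ρ) {i : ℕ} {x' : Fin (z+1)} {ya : Fin z}
    (hya : H.N .Ja (σ (.Ja ya)) = i) (hβ : i + 1 ≤ H.N .Jβ (σ (.JB x'))) :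
    σ (.Ja ya) + pJob z D ι (.Ja ya) ≤ σ (.JB x') := by
  obtain ⟨k, k', hkk, hky⟩ := H.mach (.Ja ya) trivial
  have hk23 : k = 2 ∨ k = 3 := by omega
  rcases H.disj k hky (H.both (.JB x') trivial hk23) (by simp) with h | h
  · exact h
  · have f1 := (H.fa1 (x := .Ja ya) ((H.m1 _).2 trivial) hk23 hky).2.2.1
    have f2 := (H.fa4 (x := .JB x') ((H.m4 _).2 trivial) hk23 (H.both (.JB x') trivial hk23)).2.2.1
    have m1 := H.Km k Job.Ja (by omega : σ (.JB x') ≤ σ (.Ja ya))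
    have m2 := H.Km k Job.Jδ (by omega : σ (.JB x') ≤ σ (.Ja ya))
    omega

theorem arith3 {i B c α l a b γ δ a2 a3 b2 b3 γ2 γ3 δ2 δ3 : ℕ}
    (h1 : B = α + l ∧ c = B ∧ a2 + δ2 = a ∧ b2 + γ2 = α ∧ a2 + b2 = a)
    (h2 : B = α + l ∧ c = B ∧ a3 + δ3 = a ∧ b3 + γ3 = α ∧ a3 + b3 = a)
    (h3 : a = a2 + a3 ∧ b = b2 + b3 ∧ γ = γ2 + γ3 ∧ δ = δ2 + δ3) (h4 : 1 ≤ l) (h5 : B ≤ i + 1)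
    (h6 : i ≤ b) (h7 : i ≤ γ) : a = i ∧ b = i := by
  omega

/-- the two middle machines -/
def KK (k k' : ℕ) : Prop := k = 2 ∧ k' = 3 ∨ k = 3 ∧ k' = 2

theorem KK.l {k k' : ℕ} (h : KK k k') : k = 2 ∨ k = 3 := by unfold KK at h; omega
theorem KK.r {k k' : ℕ} (h : KK k k') : k' = 2 ∨ k' = 3 := by unfold KK at h; omega

theorem Ctx.mach2 (H : Ctx z D ι σ ρ) (x : Job z) (h : OneM23 x) :
    ∃ k k', KK k k' ∧ k ∈ ρ x := H.mach x h

set_option maxHeartbeats 1000000 in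
theorem Ctx.claim3c (H : Ctx z D ι σ ρ) {i : ℕ} (hi : i < z) {x x' : Fin (z+1)}
    (h : St H i (σ (.JB x))) (hx' : H.N .JB (σ (.JB x')) = i + 1) :
    H.N .JA (σ (.JB x')) = i + 1 := by
  obtain ⟨s, hs⟩ := H.nth H.chA (by omega : i < z + 1)
  have hsT := H.claim3a hi h hs hx'
  have hge := H.ended .JA s hsT
  by_contra hne
  have hge2 : i + 2 ≤ H.N .JA (σ (.JB x')) := by omega
  obtain ⟨c2B, c2c, c2α, c2l, c2a, c2b, c2γ, c2δ⟩ := H.claim2 hi h hs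
  have hL : H.N L2 (σ (.JB x')) ≤ 1 := cN_le _ _ _ _
  obtain ⟨g1, g2, -⟩ := H.fB2 x'
  obtain ⟨ya, hya⟩ := H.nth H.cha hi
  have hyaT := H.claim3b hya (x' := x') (by omega)
  obtain ⟨k, k', hkk, hky⟩ := H.mach2 (.Ja ya) trivial
  have hBa := (H.aftera h hya).2
  have hBa' := H.Nm .JB (by omega : σ (.Ja ya) ≤ σ (.JB x'))
  have hca := (H.fa1 (x := .Ja ya) ((H.m1 _).2 trivial) hkk.l hky).2.1
  obtain ⟨yc, hyc⟩ := H.nth H.chc (by omega : i + 1 < z + 1)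
  have haC := H.later k (x := .Ja ya) (f := Job.Jc) (y := yc) hky (H.both (.Jc yc) trivial hkk.l)
    (by simp) (by omega)
  have hSC := H.later k (x := .JA s) (f := Job.Jc) (y := yc) (H.both (.JA s) trivial hkk.l)
    (H.both (.Jc yc) trivial hkk.l) (by simp) (by omega)
  have hSa := H.later 1 (x := .JA s) (f := Job.Ja) (y := ya) ((H.m1 _).2 trivial)
    ((H.m1 _).2 trivial) (by simp) (by omega)
  have hCT := H.ends H.chc (y := yc) (t := σ (.JB x')) (by omega)
  clear hca hBa hBa' hyaT hCT hL g1 g2 hge hsT hne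
  obtain ⟨s', hs'⟩ := H.nth H.chA (by omega : i + 1 < z + 1)
  have hs'T := H.ends H.chA (y := s') (t := σ (.JB x')) (by omega)
  have hSS := H.ends H.chA (y := s) (t := σ (.JA s')) (by omega)
  have hab : H.N .Ja (σ (.JA s')) = i ∧ H.N .Jb (σ (.JA s')) = i := by
    have n1 := H.Nm .JB (by omega : σ (.JA s') ≤ σ (.JB x'))
    have n2 := H.Nm .Jb (by omega : σ (.JA s) ≤ σ (.JA s'))
    have n3 := H.Nm .Jγ (by omega : σ (.JA s) ≤ σ (.JA s'))
    have n4 := H.Nm L1 (by omega : σ (.JA s) ≤ σ (.JA s'))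
    rw [hx'] at n1
    rw [c2b] at n2
    rw [c2γ] at n3
    rw [c2l] at n4
    exact arith3 (H.fA2 s') (H.fA3 s') (H.splits _) n4 n1 n2 n3
  clear hs'T hSS hge2 hx'
  obtain ⟨yb, hyb⟩ := H.nth H.chb hi
  obtain ⟨kb, kb', hkkb, hkyb⟩ := H.mach2 (.Jb yb) trivial
  have hS'b := H.later kb (x := .JA s') (f := Job.Jb) (y := yb) (H.both (.JA s') trivial hkkb.l)
    hkyb (by simp) (by omega)
  have e1 := H.ended .JA s' hS'b
  obtain ⟨-, hcb, -⟩ := H.fa4 (x := .Jb yb) ((H.m4 _).2 trivial) hkkb.l hkyb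
  have hCb := H.ends H.chc (y := yc) (t := σ (.Jb yb)) (by omega)
  clear e1 hcb hS'b hab hs'
  have n5 := H.Nm .Jb (by omega : σ (.Jc yc) ≤ σ (.Jb yb))
  have q5 : σ (.JA s) ≤ σ (.Jc yc) := by omega
  have n6 := H.Nm .Jb q5
  have e := H.ended .Ja ya haC
  have q0 : H.N .Jb (σ (.JA s)) = H.N .Ja (σ (.JA s)) := by omega
  have q1 : H.N .Jb (σ (.JA s)) = H.N .Jb (σ (.Jc yc)) := by omega
  have q2 : H.N .Ja (σ (.JA s)) < H.N .Ja (σ (.Jc yc)) := by omega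
  have q3 : H.N .Ja (σ (.Ja ya)) = H.N .Ja (σ (.JA s)) := by omega
  have q4 : σ (.JA s) ≤ σ (.Ja ya) := by omega
  have f3 := H.fact23 (x := .Jc yc) (H.both (.Jc yc) trivial (Or.inl rfl))
    (H.both (.Jc yc) trivial (Or.inr rfl))
  have f4 := (H.fA2 s).2.2.2.2
  have f5 := (H.fA3 s).2.2.2.2
  have s1 := H.splits (σ (.JA s))
  have s2 := H.splits (σ (.Jc yc))
  have m := H.Km2 q5
  have ar1 := arith1 q0 ((add_comm _ _).trans f4) ((add_comm _ _).trans f5) s1.2.1 s1.1 s2.2.1 s2.1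
    ((add_comm _ _).trans (f3.trans (add_comm _ _))) m.1.2.1 m.2.2.1 q1 q2
  refine H.excl hkk 1 Job.Ja Job.Jb (fun _ => (H.m1 _).2 trivial) (fun _ => trivial)
    (fun _ => trivial) (.JA s) ((H.m1 _).2 trivial) (fun _ => by simp) ?_ ya hky q3 q4
    (C := σ (.Jc yc)) ?_ q1.symm ?_
  · intro w hw
    exact (add_comm _ _).trans (H.fa1 (x := .Ja w) ((H.m1 _).2 trivial) hkk.r hw).2.2.2.2
  · rcases hkk with ⟨rfl, rfl⟩ | ⟨rfl, rfl⟩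
    · exact ar1.1
    · exact ar1.2.1
  · rcases hkk with ⟨rfl, rfl⟩ | ⟨rfl, rfl⟩
    · exact ar1.2.2.2
    · exact ar1.2.2.1

theorem Ctx.Q_eq (H : Ctx z D ι σ ρ) {k s t : ℕ} (h : s ≤ t) (hc : H.N .Jc s = H.N .Jc t)
    (ha : H.K k .Ja s = H.K k .Ja t) (hb : H.K k .Jb s = H.K k .Jb t)
    (hγ : H.K k .Jγ s = H.K k .Jγ t) (hδ : H.K k .Jδ s = H.K k .Jδ t) : H.Q k s = H.Q k t := by
  have e1 : ∀ i, (σ (.Jc i) + pJob z D ι (.Jc i) ≤ s ↔ σ (.Jc i) + pJob z D ι (.Jc i) ≤ t) := by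
    intro i
    refine ⟨fun h' => h'.trans h, fun h' => ?_⟩
    by_contra hn
    have : H.N .Jc s < H.N .Jc t := cN_lt (pJob z D ι) σ Job.Jc i (s := s) (t := t) (by omega) h'
    omega
  have e2 : ∀ f : Fin z → Job z, H.K k f s = H.K k f t → ∀ i,
      (k ∈ ρ (f i) ∧ σ (f i) + pJob z D ι (f i) ≤ s ↔ k ∈ ρ (f i) ∧ σ (f i) + pJob z D ι (f i) ≤ t) := by
    intro f hf i
    refine ⟨fun h' => ⟨h'.1, h'.2.trans h⟩, fun h' => ⟨h'.1, ?_⟩⟩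
    by_contra hn
    have : H.K k f s < H.K k f t := cK_lt (pJob z D ι) σ ρ k f i h'.1 (s := s) (t := t) (by omega) h'.2
    omega
  unfold Ctx.Q
  simp only [e1, e2 _ hγ, e2 _ hδ, ha, hb]

theorem arith4 {i A c β l a b γ δ a2 a3 b2 b3 γ2 γ3 δ2 δ3 : ℕ}
    (h1 : A = β + l ∧ c = A ∧ a2 + δ2 = β ∧ b2 + γ2 = b ∧ a2 + b2 = b)
    (h2 : A = β + l ∧ c = A ∧ a3 + δ3 = β ∧ b3 + γ3 = b ∧ a3 + b3 = b)
    (h3 : a = a2 + a3 ∧ b = b2 + b3 ∧ γ = γ2 + γ3 ∧ δ = δ2 + δ3) (h4 : β = i)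
    (h5 : i ≤ a) (h6 : i ≤ δ) : a = i ∧ b = i ∧ γ = i ∧ δ = i := by
  omega

theorem arith5 {z i : ℕ} (hi : i < z)
    (h : 3 * z * i + 4 * z * i + z * 1 = 3 * z * i + (4 * z - 1) * i + 2 * z * 1) : False := by
  obtain ⟨u, hu⟩ : ∃ u, 4 * z = u + 1 := ⟨4 * z - 1, by omega⟩
  have : 4 * z - 1 = u := by omega
  rw [this, hu] at h
  nlinarith

theorem arith6 {i a b c d a' b' : ℕ} (h1 : a' = a + b) (h2 : b' = c + d) (h3 : a' = i) (h4 : b' = i)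
    (h5 : a ≤ c) (h6 : b ≤ d) : a = c := by omega

set_option maxHeartbeats 1000000 in
theorem Ctx.claim4 (H : Ctx z D ι σ ρ) {i : ℕ} (hi : i < z) {x x' : Fin (z+1)}
    (h : St H i (σ (.JB x))) (hx' : H.N .JB (σ (.JB x')) = i + 1) :
    H.N L2 (σ (.JB x')) = 0 := by
  obtain ⟨s, hs⟩ := H.nth H.chA (by omega : i < z + 1)
  have hsT := H.claim3a hi h hs hx'
  have hA := H.claim3c hi h hx'
  by_contra hne
  have hL : H.N L2 (σ (.JB x')) ≤ 1 := cN_le _ _ _ _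
  have hL : H.N L2 (σ (.JB x')) = 1 := by omega
  have fB := H.fB2 x'
  obtain ⟨g1, g2, -⟩ := H.fB2 x'
  have hβ : H.N .Jβ (σ (.JB x')) = i := by omega
  obtain ⟨c2B, c2c, c2α, c2l, c2a, c2b, c2γ, c2δ⟩ := H.claim2 hi h hs
  have q : σ (.JA s) ≤ σ (.JB x') := by omega
  have n1 := H.Nm .Ja q
  have n2 := H.Nm .Jδ q
  rw [c2a] at n1
  rw [c2δ] at n2
  obtain ⟨da, db, dγ, dδ⟩ := arith4 fB (H.fB3 x') (H.splits _) hβ n1 n2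
  obtain ⟨⟨m1, m2, m3, m4⟩, ⟨m5, m6, m7, m8⟩⟩ := H.Km2 q
  obtain ⟨s1, s2, s3, s4⟩ := H.splits (σ (.JA s))
  obtain ⟨t1, t2, t3, t4⟩ := H.splits (σ (.JB x'))
  have hQ := H.Q_eq (k := 2) q (by omega) (arith6 s1 t1 c2a da m1 m5) (arith6 s2 t2 c2b db m2 m6)
    (arith6 s3 t3 c2γ dγ m3 m7) (arith6 s4 t4 c2δ dδ m4 m8)
  have F1 := (H.fact1 (x := .JA s) ((H.m1 _).2 trivial) (Or.inl rfl)
    (H.both (.JA s) trivial (Or.inl rfl))).2.2.2.2.2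
  have F2 := (H.fact4 (x := .JB x') ((H.m4 _).2 trivial) (Or.inl rfl)
    (H.both (.JB x') trivial (Or.inl rfl))).2.2.2.2.2
  rw [hQ, F2, db, hβ, hL, c2a, c2α, c2l] at F1
  exact arith5 hi F1.symm

theorem arith7 {i A c β l a b γ δ a2 a3 b2 b3 γ2 γ3 δ2 δ3 : ℕ}
    (h1 : A = β + l ∧ c = A ∧ a2 + δ2 = β ∧ b2 + γ2 = b ∧ a2 + b2 = b)
    (h2 : A = β + l ∧ c = A ∧ a3 + δ3 = β ∧ b3 + γ3 = b ∧ a3 + b3 = b)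
    (h3 : a = a2 + a3 ∧ b = b2 + b3 ∧ γ = γ2 + γ3 ∧ δ = δ2 + δ3) (h4 : β = i + 1)
    (h5 : i + 1 = a) : b = i + 1 ∧ γ = i + 1 ∧ δ = i + 1 := by
  omega

set_option maxHeartbeats 1000000 in
theorem Ctx.claim5 (H : Ctx z D ι σ ρ) {i : ℕ} (hi : i < z) {x x' : Fin (z+1)}
    (h : St H i (σ (.JB x))) (hx' : H.N .JB (σ (.JB x')) = i + 1) :
    St H (i + 1) (σ (.JB x')) := by
  have hA := H.claim3c hi h hx'
  have hL := H.claim4 hi h hx'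
  have fB := H.fB2 x'
  obtain ⟨g1, g2, -⟩ := H.fB2 x'
  have hβ : H.N .Jβ (σ (.JB x')) = i + 1 := by omega
  obtain ⟨ya, hya⟩ := H.nth H.cha hi
  have hyaT := H.claim3b hya (x' := x') (by omega)
  have e1 := H.ended .Ja ya hyaT
  have ha : i + 1 = H.N .Ja (σ (.JB x')) := by
    by_contra hne
    have hle : H.N .Ja (σ (.JB x')) ≤ z := cN_le _ _ _ _
    obtain ⟨y, hy⟩ := H.nth H.cha (by omega : i + 1 < z)
    have hyT := H.ends H.cha (y := y) (t := σ (.JB x')) (by omega)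
    obtain ⟨k, k', hkk, hky⟩ := H.mach (.Ja y) trivial
    have hk23 : k = 2 ∨ k = 3 := by omega
    have f1 := (H.fa1 (x := .Ja y) ((H.m1 _).2 trivial) hk23 hky).2.2.1
    have f2 := (H.fa4 (x := .JB x') ((H.m4 _).2 trivial) hk23 (H.both (.JB x') trivial hk23)).2.2.1
    have m2 := H.Km k Job.Jδ (by omega : σ (.Ja y) ≤ σ (.JB x'))
    have m1 : H.K k .Ja (σ (.Ja y)) < H.K k .Ja (σ (.JB x')) :=
      cK_lt (pJob z D ι) σ ρ k Job.Ja y hky (by have := H.ppos (.Ja y); omega) hyT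
    omega
  obtain ⟨db, dγ, dδ⟩ := arith7 fB (H.fB3 x') (H.splits _) hβ ha
  exact ⟨hA, hx', by omega, hβ, hL, ha.symm, db, dγ, dδ⟩

theorem Ctx.pos (H : Ctx z D ι σ ρ) (x : Job z) (hx : 4 ∈ ρ x) {β l B b : ℕ}
    (h1 : H.N .Jβ (σ x) = β) (h2 : H.N L2 (σ x) = l) (h3 : H.N .JB (σ x) = B)
    (h4 : H.N .Jb (σ x) = b) :
    σ x = 0 + (β + l) * D^2 + B * D^3 + β * D^4 + b * D^5 + b * D^6
      + (3 * z * b + (4 * z - 1) * β + 2 * z * l) * D^7 + (β + l) * D^8 := by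
  have := H.f4 x hx
  rw [h1, h2, h3, h4] at this
  exact this

theorem Ctx.claim6 (H : Ctx z D ι σ ρ) {i : ℕ} (hi : i < z) {x x' : Fin (z+1)}
    (h : St H i (σ (.JB x))) (hx' : H.N .JB (σ (.JB x')) = i + 1) :
    ∃ y w, σ (.Jβ y) = σ (.JB x) + D^3 ∧ σ (.Jb w) = σ (.Jβ y) + pJob z D ι (.Jβ y) ∧
      σ (.JB x') = σ (.Jb w) + pJob z D ι (.Jb w) := by
  have h' := H.claim5 hi h hx'
  obtain ⟨y, hy⟩ := H.nth H.chβ hi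
  obtain ⟨w, hw⟩ := H.nth H.chb hi
  have hwT := H.ends H.chb (y := w) (t := σ (.JB x')) (by rw [h'.b, hw]; omega)
  have n1 := H.Nm L2 (by omega : σ (.Jb w) ≤ σ (.JB x'))
  have hA := H.claim1 hi h hw
  obtain ⟨k, k', hkk, hky⟩ := H.mach (.Jb w) trivial
  obtain ⟨g1, -⟩ := H.fa4 (x := .Jb w) ((H.m4 _).2 trivial) (by omega) hky
  have hl := h'.l
  have n2 := H.Nm .Jβ (by omega : σ (.Jb w) ≤ σ (.JB x'))
  have hβ := h'.β
  have hyw := H.ends H.chβ (y := y) (t := σ (.Jb w)) (by omega)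
  have n3 := H.Nm L2 (by omega : σ (.Jβ y) ≤ σ (.JB x'))
  have n4 := H.Nm .JB (by omega : σ (.Jβ y) ≤ σ (.JB x'))
  have n5 := H.Nm .JB (by omega : σ (.Jb w) ≤ σ (.JB x'))
  have n6 := (H.afterβ h hy).2
  have n7 := (H.afterb h hw).2
  have n8 := H.Nm .Jb (by have := (H.afterβ h hy).1; omega : σ (.JB x) ≤ σ (.Jβ y))
  have n9 := H.Nm .Jb (by omega : σ (.Jβ y) ≤ σ (.Jb w))
  have hb := h.b
  have p1 := H.pos (.JB x) ((H.m4 _).2 trivial) h.β h.l h.B h.b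
  have p2 := H.pos (.Jβ y) ((H.m4 _).2 trivial) hy (l := 0) (by omega) (B := i + 1) (by omega)
    (b := i) (by omega)
  have p3 := H.pos (.Jb w) ((H.m4 _).2 trivial) (β := i + 1) (by omega) (l := 0) (by omega)
    (B := i + 1) (by omega) hw
  have p4 := H.pos (.JB x') ((H.m4 _).2 trivial) h'.β h'.l h'.B h'.b
  refine ⟨y, w, ?_, ?_, ?_⟩
  · rw [p1, p2]; ring
  · rw [p2, p3]
    simp only [pJob]
    generalize 4 * z - 1 = u
    ring
  · rw [p3, p4]
    simp only [pJob]
    generalize 4 * z - 1 = u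
    ring

theorem Ctx.N0 (H : Ctx z D ι σ ρ) {n : ℕ} (f : Fin n → Job z) : H.N f 0 = 0 := by
  by_contra h
  have h0 : cN (pJob z D ι) σ f 0 ≠ 0 := h
  unfold cN at h0
  obtain ⟨i, hi⟩ := Finset.card_pos.mp (Nat.pos_of_ne_zero h0)
  simp only [mem_filter, mem_univ, true_and] at hi
  have := H.ppos (f i)
  omega

theorem Ctx.cntB (H : Ctx z D ι σ ρ) (g : Fin (z+1) → Fin (z+1)) (hg : Function.Injective g)
    (hm : Monotone fun i => σ (.JB (g i))) (i : Fin (z+1)) :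
    H.N .JB (σ (.JB (g i))) = i.val := by
  have key : (univ.filter fun y => σ (.JB y) + pJob z D ι (.JB y) ≤ σ (.JB (g i)))
      = (Finset.Iio i).image g := by
    ext y
    obtain ⟨j, rfl⟩ := (Finite.injective_iff_surjective.mp hg) y
    simp only [mem_filter, mem_univ, true_and, mem_image, mem_Iio]
    have hp := H.ppos (.JB (g j))
    have hp' := H.ppos (.JB (g i))
    constructor
    · intro h
      refine ⟨j, ?_, rfl⟩
      by_contra hn
      have := hm (not_lt.mp hn)
      simp only at this
      omega
    · rintro ⟨j', hj, he⟩
      obtain rfl := hg he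
      have h1 := hm hj.le
      simp only at h1
      rcases H.chB (g j') (g i) (fun h => hj.ne (hg h)) with h | h <;> omega
  have : H.N .JB (σ (.JB (g i))) =
    (univ.filter fun y => σ (.JB y) + pJob z D ι (.JB y) ≤ σ (.JB (g i))).card := by
    simp only [Ctx.N, cN]
  rw [this, key, Finset.card_image_of_injective _ hg, Fin.card_Iio]

end helpers

/-- Machine 4 processes its jobs in the order
`B₀, β⁽¹⁾, b⁽¹⁾, B₁, …, β⁽ᶻ⁾, b⁽ᶻ⁾, B_z, λ₂`; consequently
`σ(Bᵢ) = i(D²+D³+D⁴+D⁵+D⁶) + i(7z−1)D⁷ + iD⁸`. -/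
theorem machine4_order
    (z D : ℕ) (ι : Fin (3*z) → ℕ)
    (hz : 0 < z) (hDpos : 0 < D)
    (hιpos : ∀ i, 0 < ι i)
    (hsum : ∑ i, ι i = z * D)
    (hlow : ∀ i, D < 4 * ι i)
    (hhigh : ∀ i, 2 * ι i < D)
    (hD : 4*z*(7*z+1) < D)
    (σ : Job z → ℕ) (ρ : Job z → Finset ℕ)
    (hfeas : Feasible 4 (pJob z D ι) (qJob z) σ ρ)
    (hmk : makespan (pJob z D ι) σ = Wval z D)
    (hnf : NormalForm ρ)
    (Benum : Fin (z+1) → Job z)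
    (hBmem : ∀ i, Benum i ∈ sB z)
    (hBinj : Function.Injective Benum)
    (hBmono : Monotone fun i => σ (Benum i))
    (hfirst : ∃ j ∈ sB z, 2 ∈ ρ j ∧ σ j = 0) :
    (∀ i : Fin (z+1),
      σ (Benum i) = i.val*(D^2 + D^3 + D^4 + D^5 + D^6) + i.val*(7*z-1)*D^7 + i.val*D^8) ∧
    (∀ i : Fin z, ∃ β' ∈ sβ z, ∃ b' ∈ sb z,
      σ β' = σ (Benum i.castSucc) + D^3 ∧
      σ b' = σ β' + pJob z D ι β' ∧
      σ (Benum i.succ) = σ b' + pJob z D ι b') ∧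
    σ Job.Jl2 = σ (Benum (Fin.last z)) + D^3 := by
  have H : Ctx z D ι σ ρ := ⟨hz, hιpos, hsum, hD, hfeas, hmk, hnf⟩
  have hex : ∀ i, ∃ y, Job.JB y = Benum i := by
    intro i
    simpa [sB] using hBmem i
  choose g hg using hex
  obtain rfl : Benum = fun i => Job.JB (g i) := by
    funext i
    exact (hg i).symm
  have hginj : Function.Injective g := fun a b h => hBinj (by simp only [h])
  have hc := H.cntB g hginj hBmono
  have h0 : σ (.JB (g 0)) = 0 := by
    obtain ⟨j, hj, -, hj0⟩ := hfirst
    obtain ⟨y, rfl⟩ : ∃ y, Job.JB y = j := by simpa [sB] using hj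
    obtain ⟨k, rfl⟩ := (Finite.injective_iff_surjective.mp hginj) y
    have := hBmono (Fin.zero_le k)
    simp only at this
    omega
  have hSt : ∀ n (hn : n < z + 1), St H n (σ (.JB (g ⟨n, hn⟩))) := by
    intro n
    induction n with
    | zero =>
      intro hn
      have h0' : σ (.JB (g ⟨0, hn⟩)) = 0 := h0
      rw [h0']
      exact ⟨H.N0 _, H.N0 _, H.N0 _, H.N0 _, H.N0 _, H.N0 _, H.N0 _, H.N0 _, H.N0 _⟩
    | succ n ih =>
      intro hn
      exact H.claim5 (by omega) (ih (by omega)) (hc ⟨n + 1, hn⟩)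
  refine ⟨?_, ?_, ?_⟩
  · intro i
    have h := hSt i.val i.isLt
    have hp := H.pos (.JB (g i)) ((H.m4 _).2 trivial) h.β h.l h.B h.b
    rw [hp]
    obtain ⟨u, hu⟩ : ∃ u, 4 * z = u + 1 := ⟨4 * z - 1, by omega⟩
    have e1 : 4 * z - 1 = u := by omega
    have e2 : 7 * z - 1 = 3 * z + u := by omega
    rw [e1, e2]
    ring
  · intro i
    have h := hSt i.val (by omega)
    obtain ⟨y, w, h1, h2, h3⟩ := H.claim6 i.isLt (x := g i.castSucc) (x' := g i.succ) h
      (by have := hc i.succ; simpa using this)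
    exact ⟨Job.Jβ y, by simp [sβ], Job.Jb w, by simp [sb], h1, h2, h3⟩
  · have h := hSt z (by omega)
    have h' : St H z (σ (.JB (g (Fin.last z)))) := h
    have hl2 : H.N L2 (σ .Jl2) = 0 := by
      by_contra hne
      have hne' : cN (pJob z D ι) σ L2 (σ .Jl2) ≠ 0 := hne
      unfold cN at hne'
      obtain ⟨i, hi⟩ := Finset.card_pos.mp (Nat.pos_of_ne_zero hne')
      have := H.ppos .Jl2
      simp only [Finset.mem_filter, Finset.mem_univ, true_and] at hi
      have hi2 : σ .Jl2 + pJob z D ι .Jl2 ≤ σ .Jl2 := hi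
      omega
    have h1 := H.later 4 (x := .JB (g (Fin.last z))) (f := L2) (y := 0) ((H.m4 _).2 trivial)
      ((H.m4 _).2 trivial) (by simp) (by rw [h'.l]; exact Nat.zero_le _)
    have h2 : σ (.JB (g (Fin.last z))) + pJob z D ι (.JB (g (Fin.last z))) ≤ σ .Jl2 := h1
    have n1 := H.ended .JB (g (Fin.last z)) h2
    have n2 := H.Nm .Jβ (by omega : σ (.JB (g (Fin.last z))) ≤ σ .Jl2)
    have n3 := H.Nm .Jb (by omega : σ (.JB (g (Fin.last z))) ≤ σ .Jl2)
    have b1 : H.N .JB (σ .Jl2) ≤ z + 1 := cN_le _ _ _ _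
    have b2 : H.N .Jβ (σ .Jl2) ≤ z := cN_le _ _ _ _
    have b3 : H.N .Jb (σ .Jl2) ≤ z := cN_le _ _ _ _
    have d1 := h'.B
    have d2 := h'.β
    have d3 := h'.b
    have p1 := H.pos .Jl2 ((H.m4 _).2 trivial) (β := z) (by omega) hl2 (B := z + 1) (by omega)
      (b := z) (by omega)
    have p2 := H.pos (.JB (g (Fin.last z))) ((H.m4 _).2 trivial) h'.β h'.l h'.B h'.b
    rw [p1]
    simp only
    rw [p2]
    ring
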